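/- arXiv:1607.07827 — 2 statements merged into one kernel-verified Lean document; each statement's English description precedes it below -/
import Mathlib

section
/- Suppose p ≠ 2. Order the five G-orbits on ternary quadratic forms as O_1 = {0}, O_2 = orbit of u^2, O_3 = orbit of uv, O_4 = orbit of u^2 − l v^2 (l a non-square), O_5 = orbit of u^2 − vw, with indicator functions e_i. Then for y ∈ O_i one has q^6 · \hat{e_j}(y) = m_{ij}, where the matrix (m_{ij}) has rows: row 1: [1, q^3−1, q(q+1)(q^3−1)/2, q(q−1)(q^3−1)/2, q^2(q−1)(q^3−1)]; row 2: [1, −1, q(q+1)(q^2−1)/2, −q(q−1)(q^2+1)/2, −q^2(q−1)]; row 3: [1, q^2−1, q(q^2−2q−1)/2, q(q−1)^2/2, −q^2(q−1)]; row 4: [1, −q^2−1, q(q^2−1)/2, q(q^2+1)/2, −q^2(q−1)]; row 5: [1, −1, −q(q+1)/2, −q(q−1)/2, q^2]. -/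
open scoped Classical
open MvPolynomial Matrix

noncomputable section

/-- The standard additive character `t ↦ exp(2πi·Tr_{F/F_p}(t)/p)` of a finite field `F`
of characteristic `p`. -/
def psiF (p : ℕ) [Fact p.Prime] (F : Type*) [Field F] [Fintype F] [CharP F p] (t : F) : ℂ :=
  letI : Algebra (ZMod p) F := ZMod.algebra F p
  Complex.exp (2 * Real.pi * Complex.I * ((Algebra.trace (ZMod p) F t).val : ℂ) / (p : ℂ))

variable {F : Type*} [Field F] [Fintype F]

/-- The ternary quadratic form `a u² + b uv + c uw + d v² + e vw + f w²`
attached to `(a,b,c,d,e,f)`. -/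
def TQ (c : Fin 6 → F) : MvPolynomial (Fin 3) F :=
  C (c 0) * X 0 ^ 2 + C (c 1) * X 0 * X 1 + C (c 2) * X 0 * X 2 +
    C (c 3) * X 1 ^ 2 + C (c 4) * X 1 * X 2 + C (c 5) * X 2 ^ 2

/-- Substitution corresponding to the linear change of variables `(u,v,w) ↦ (u,v,w)·g`. -/
def subst3 (g : Matrix (Fin 3) (Fin 3) F) (P : MvPolynomial (Fin 3) F) : MvPolynomial (Fin 3) F :=
  aeval (fun j => ∑ i : Fin 3, C (g i j) * X i) P

/-- `x` lies in the `GL₁(F) × GL₃(F)`-orbit of `r` (ternary quadratic forms). -/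
def InOrbitTQ (r x : Fin 6 → F) : Prop :=
  ∃ (t : Fˣ) (g : Matrix.GeneralLinearGroup (Fin 3) F),
    C (t : F) * subst3 (g : Matrix (Fin 3) (Fin 3) F) (TQ r) = TQ x

/-- The bilinear form `[x,x'] = aa' + bb'/2 + cc'/2 + dd' + ee'/2 + ff'`
on ternary quadratic forms. -/
def bformTQ (x y : Fin 6 → F) : F :=
  x 0 * y 0 + x 1 * y 1 / 2 + x 2 * y 2 / 2 + x 3 * y 3 + x 4 * y 4 / 2 + x 5 * y 5

/-- The Fourier transform on the space of ternary quadratic forms over `F`. -/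
def FTTQ (p : ℕ) [Fact p.Prime] [CharP F p] (Φ : (Fin 6 → F) → ℂ) (y : Fin 6 → F) : ℂ :=
  ((Fintype.card F : ℂ) ^ 6)⁻¹ * ∑ x : Fin 6 → F, Φ x * psiF p F (bformTQ x y)


/-! ### The additive character and one-variable sums -/

theorem psiF_eq_stdAddChar (p : ℕ) [Fact p.Prime] [CharP F p] (t : F) :
    letI : Algebra (ZMod p) F := ZMod.algebra F p
    psiF p F t = ZMod.stdAddChar (Algebra.trace (ZMod p) F t) := by
  let _ : Algebra (ZMod p) F := ZMod.algebra F p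
  have h := ZMod.stdAddChar_coe (N := p) ((Algebra.trace (ZMod p) F t).val : ℤ)
  rw [Int.cast_natCast, ZMod.natCast_zmod_val] at h
  rw [h, Int.cast_natCast]
  rfl

theorem exists_isPrimitive_eq_psiF (p : ℕ) [Fact p.Prime] [CharP F p] :
    ∃ ψ : AddChar F ℂ, ψ.IsPrimitive ∧ ∀ t, psiF p F t = ψ t := by
  let _ : Algebra (ZMod p) F := ZMod.algebra F p
  refine ⟨ZMod.stdAddChar.compAddMonoidHom (Algebra.trace (ZMod p) F).toAddMonoidHom,
    AddChar.IsPrimitive.of_ne_one fun h => ?_, fun t => psiF_eq_stdAddChar p t⟩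
  obtain ⟨a, ha⟩ := Algebra.trace_surjective (ZMod p) F 1
  have h1 := DFunLike.congr_fun h a
  have h2 : (ZMod.stdAddChar (1 : ZMod p) : ℂ) = ZMod.stdAddChar (0 : ZMod p) := by
    simpa [ha] using h1
  exact one_ne_zero (ZMod.injective_stdAddChar h2)

section CharacterSums

variable {ψ : AddChar F ℂ}

theorem sum_char_mul (hψ : ψ.IsPrimitive) {c : F} (hc : c ≠ 0) : ∑ a, ψ (c * a) = 0 := by
  simpa [mul_comm, hc] using AddChar.sum_mulShift c hψ

theorem sum_char_mul_mul (hψ : ψ.IsPrimitive) {c : F} (hc : c ≠ 0) :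
    ∑ x : F × F, ψ (c * (x.1 * x.2)) = Fintype.card F := by
  rw [Fintype.sum_prod_type]
  have h (a : F) : ∑ b, ψ (c * (a * b)) = if a = 0 then (Fintype.card F : ℂ) else 0 := by
    split_ifs with ha
    · simp [ha]
    · simpa [mul_assoc] using sum_char_mul hψ (mul_ne_zero hc ha)
  simp [h]

theorem sum_char_sq (h2 : ringChar F ≠ 2) (c : F) :
    ∑ a, ψ (c * a ^ 2) = ∑ x, ((quadraticChar F x : ℂ) + 1) * ψ (c * x) := by
  have h (x : F) : ((quadraticChar F x : ℂ) + 1) =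
      (Finset.univ.filter fun a : F => a ^ 2 = x).card := by
    have := quadraticChar_card_sqrts h2 x
    rw [Set.toFinset_ofPred] at this
    exact_mod_cast this.symm
  rw [← Finset.sum_fiberwise Finset.univ (fun a : F => a ^ 2)]
  refine Finset.sum_congr rfl fun x _ => ?_
  rw [h, ← nsmul_eq_mul, ← Finset.sum_const]
  refine Finset.sum_congr rfl fun a ha => ?_
  rw [(Finset.mem_filter.1 ha).2]

theorem sum_char_nonsquare_mul_sq (hψ : ψ.IsPrimitive) (h2 : ringChar F ≠ 2) {l : F}
    (hl : ¬ IsSquare l) {c : F} (hc : c ≠ 0) :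
    ∑ a, ψ (c * (l * a ^ 2)) = -∑ a, ψ (c * a ^ 2) := by
  have hl0 : l ≠ 0 := fun h => hl (h ▸ IsSquare.zero)
  have hχ : quadraticChar F l = -1 := quadraticChar_neg_one_iff_not_isSquare.2 hl
  have e : ∑ a, ψ (c * (l * a ^ 2)) = ∑ x, (-(quadraticChar F x : ℂ) + 1) * ψ (c * x) := by
    simp_rw [← mul_assoc]
    rw [sum_char_sq h2, ← Equiv.sum_comp (Equiv.mulLeft₀ l hl0)
      (fun x => (-(quadraticChar F x : ℂ) + 1) * ψ (c * x))]
    refine Finset.sum_congr rfl fun x _ => ?_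
    have hx : quadraticChar F (l * x) = -quadraticChar F x := by rw [map_mul, hχ, neg_one_mul]
    change _ = (-(quadraticChar F (l * x) : ℂ) + 1) * ψ (c * (l * x))
    rw [hx, Int.cast_neg, neg_neg, mul_assoc]
  rw [e, sum_char_sq h2, ← sub_eq_zero, sub_neg_eq_add, ← Finset.sum_add_distrib]
  trans 2 * ∑ x, ψ (c * x)
  · rw [Finset.mul_sum]
    exact Finset.sum_congr rfl fun x _ => by ring
  · rw [sum_char_mul hψ hc, mul_zero]

theorem sum_char_norm (hψ : ψ.IsPrimitive) (h2 : ringChar F ≠ 2) {l : F}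
    (hl : ¬ IsSquare l) {c : F} (hc : c ≠ 0) :
    ∑ x : F × F, ψ (c * (x.1 ^ 2 - l * x.2 ^ 2)) = -Fintype.card F := by
  have h20 : (2 : F) ≠ 0 := Ring.two_ne_zero h2
  have split (m : F) : ∑ x : F × F, ψ (c * (x.1 ^ 2 - m * x.2 ^ 2)) =
      (∑ a, ψ (c * a ^ 2)) * ∑ b, ψ (-c * (m * b ^ 2)) := by
    rw [Fintype.sum_prod_type, Finset.sum_mul_sum]
    refine Finset.sum_congr rfl fun a _ => Finset.sum_congr rfl fun b _ => ?_
    rw [← AddChar.map_add_eq_mul]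
    congr 1; ring
  rw [split, sum_char_nonsquare_mul_sq hψ h2 hl (neg_ne_zero.2 hc), mul_neg,
    ← sum_char_mul_mul hψ hc]
  have := split 1
  simp only [one_mul] at this
  rw [← this]
  let e : F × F ≃ F × F :=
    { toFun := fun x => (x.1 - x.2, x.1 + x.2)
      invFun := fun x => ((x.1 + x.2) / 2, (x.2 - x.1) / 2)
      left_inv := fun x => by ext <;> simp <;> field_simp <;> ring
      right_inv := fun x => by ext <;> simp <;> field_simp <;> ring }
  rw [← e.sum_comp fun x => ψ (c * (x.1 * x.2))]
  congr 1
  refine Finset.sum_congr rfl fun x _ => ?_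
  simp only [e, Equiv.coe_fn_mk]
  congr 1; ring

theorem sum_units_sum_char_sq (hψ : ψ.IsPrimitive) :
    ∑ t : Fˣ, ∑ a, ψ (t * a ^ 2) = 0 := by
  have h (s : F → ℂ) : ∑ t : Fˣ, s t = ∑ t, s t - s 0 := by
    rw [← Finset.sum_erase_eq_sub (Finset.mem_univ (0 : F))]
    refine Finset.sum_bij' (fun t _ => (t : F))
      (fun t ht => Units.mk0 t (Finset.ne_of_mem_erase ht)) ?_ ?_ ?_ ?_ ?_ <;> simp
  rw [h fun t => ∑ a, ψ (t * a ^ 2), Finset.sum_comm]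
  have h' (a : F) : ∑ t, ψ (t * a ^ 2) = if a = 0 then (Fintype.card F : ℂ) else 0 := by
    rw [AddChar.sum_mulShift _ hψ]
    simp
  simp [h']

end CharacterSums

/-! ### Forms as coefficient vectors -/

section Forms

variable {K : Type*} [Field K]

/-- The coefficients of the product of the linear forms with coefficients `a` and `b`. -/
def linProd (a b : Fin 3 → K) : Fin 6 → K :=
  ![a 0 * b 0, a 0 * b 1 + a 1 * b 0, a 0 * b 2 + a 2 * b 0, a 1 * b 1,
    a 1 * b 2 + a 2 * b 1, a 2 * b 2]

/-- The polar form of the quadratic form `x`, normalised so that `qpolar x v v` is twice the value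
of `x` at `v`. -/
def qpolar (x : Fin 6 → K) (v w : Fin 3 → K) : K :=
  2 * x 0 * v 0 * w 0 + x 1 * (v 0 * w 1 + v 1 * w 0) + x 2 * (v 0 * w 2 + v 2 * w 0) +
    2 * x 3 * v 1 * w 1 + x 4 * (v 1 * w 2 + v 2 * w 1) + 2 * x 5 * v 2 * w 2

/-- The value of the quadratic form `x` at `v`. -/
def qval (x : Fin 6 → K) (v : Fin 3 → K) : K :=
  x 0 * v 0 ^ 2 + x 1 * v 0 * v 1 + x 2 * v 0 * v 2 + x 3 * v 1 ^ 2 + x 4 * v 1 * v 2 +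
    x 5 * v 2 ^ 2

/-- The action of `(t, g)` on coefficient vectors. -/
def formAct (t : K) (g : Matrix (Fin 3) (Fin 3) K) (x : Fin 6 → K) : Fin 6 → K :=
  t • ![qval x (g 0), qpolar x (g 0) (g 1), qpolar x (g 0) (g 2), qval x (g 1),
    qpolar x (g 1) (g 2), qval x (g 2)]

theorem C_mul_subst3_TQ (t : K) (g : Matrix (Fin 3) (Fin 3) K) (x : Fin 6 → K) :
    C t * subst3 g (TQ x) = TQ (formAct t g x) := by
  have h2 : (C 2 : MvPolynomial (Fin 3) K) = 2 := map_ofNat C 2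
  simp [TQ, subst3, formAct, qval, qpolar, Fin.sum_univ_three, MvPolynomial.algebraMap_eq, h2]
  ring

theorem TQ_injective : Function.Injective (TQ : (Fin 6 → K) → _) := by
  intro x y h
  have ev (v : Fin 3 → K) : qval x v = qval y v := by
    simpa [TQ, qval] using congrArg (MvPolynomial.eval v) h
  have h0 := ev ![1, 0, 0]
  have h3 := ev ![0, 1, 0]
  have h5 := ev ![0, 0, 1]
  have h1 := ev ![1, 1, 0]
  have h2 := ev ![1, 0, 1]
  have h4 := ev ![0, 1, 1]
  simp [qval] at h0 h1 h2 h3 h4 h5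
  rw [h0, h3] at h1
  rw [h0, h5] at h2
  rw [h3, h5] at h4
  ext i
  fin_cases i <;> simp_all

theorem inOrbitTQ_iff {r x : Fin 6 → K} :
    InOrbitTQ r x ↔ ∃ (t : K) (g : Matrix (Fin 3) (Fin 3) K),
      t ≠ 0 ∧ g.det ≠ 0 ∧ formAct t g r = x := by
  simp only [InOrbitTQ, C_mul_subst3_TQ, TQ_injective.eq_iff]
  constructor
  · rintro ⟨t, g, h⟩
    exact ⟨t, g, t.ne_zero, ((Matrix.isUnit_iff_isUnit_det _).1 g.isUnit).ne_zero, h⟩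
  · rintro ⟨t, g, ht, hg, h⟩
    exact ⟨Units.mk0 t ht, Matrix.GeneralLinearGroup.mkOfDetNeZero g hg, h⟩

theorem formAct_formAct (s t : K) (g h : Matrix (Fin 3) (Fin 3) K) (x : Fin 6 → K) :
    formAct s g (formAct t h x) = formAct (s * t) (g * h) x := by
  ext i
  fin_cases i <;> simp [formAct, qval, qpolar, Matrix.mul_apply, Fin.sum_univ_three] <;> ring

theorem formAct_one (x : Fin 6 → K) : formAct 1 1 x = x := by
  ext i
  fin_cases i <;> simp [formAct, qval, qpolar]

theorem formAct_inv {t : K} {g : Matrix (Fin 3) (Fin 3) K} (ht : t ≠ 0) (hg : g.det ≠ 0)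
    (x : Fin 6 → K) : formAct t⁻¹ g⁻¹ (formAct t g x) = x := by
  rw [formAct_formAct, inv_mul_cancel₀ ht, Matrix.nonsing_inv_mul _ (isUnit_iff_ne_zero.2 hg),
    formAct_one]

theorem inOrbitTQ_symm {x y : Fin 6 → K} (h : InOrbitTQ x y) : InOrbitTQ y x := by
  obtain ⟨t, g, ht, hg, rfl⟩ := inOrbitTQ_iff.1 h
  refine inOrbitTQ_iff.2 ⟨t⁻¹, g⁻¹, inv_ne_zero ht, ?_, formAct_inv ht hg x⟩
  rw [Matrix.det_nonsing_inv]
  simpa using hg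

theorem inOrbitTQ_trans {x y z : Fin 6 → K} (h : InOrbitTQ x y) (h' : InOrbitTQ y z) :
    InOrbitTQ x z := by
  obtain ⟨t, g, ht, hg, rfl⟩ := inOrbitTQ_iff.1 h
  obtain ⟨s, k, hs, hk, rfl⟩ := inOrbitTQ_iff.1 h'
  refine inOrbitTQ_iff.2 ⟨s * t, k * g, mul_ne_zero hs ht, ?_, (formAct_formAct ..).symm⟩
  rw [Matrix.det_mul]
  exact mul_ne_zero hk hg

theorem linProd_mulVec (t : K) (g : Matrix (Fin 3) (Fin 3) K) (a b : Fin 3 → K) :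
    formAct t g (linProd a b) = t • linProd (g *ᵥ a) (g *ᵥ b) := by
  ext i
  fin_cases i <;>
    simp [formAct, qval, qpolar, linProd, Matrix.mulVec, dotProduct, Fin.sum_univ_three] <;>
    left <;> ring

theorem bformTQ_linProd_formAct (h2 : (2 : K) ≠ 0) (t : K) (g : Matrix (Fin 3) (Fin 3) K)
    (a b : Fin 3 → K) (y : Fin 6 → K) :
    bformTQ (linProd a b) (formAct t g y) = t * bformTQ (linProd (a ᵥ* g) (b ᵥ* g)) y := by
  simp [bformTQ, formAct, qval, qpolar, linProd, Matrix.vecMul, dotProduct, Fin.sum_univ_three]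
  field_simp
  ring

theorem formAct_add (t : K) (g : Matrix (Fin 3) (Fin 3) K) (x y : Fin 6 → K) :
    formAct t g (x + y) = formAct t g x + formAct t g y := by
  ext i
  fin_cases i <;> simp [formAct, qval, qpolar] <;> ring

theorem formAct_smul (t c : K) (g : Matrix (Fin 3) (Fin 3) K) (x : Fin 6 → K) :
    formAct t g (c • x) = c • formAct t g x := by
  ext i
  fin_cases i <;> simp [formAct, qval, qpolar] <;> ring

theorem bformTQ_add_left (x x' y : Fin 6 → K) :
    bformTQ (x + x') y = bformTQ x y + bformTQ x' y := by
  simp [bformTQ]; ring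

theorem bformTQ_smul_left (c : K) (x y : Fin 6 → K) :
    bformTQ (c • x) y = c * bformTQ x y := by
  simp [bformTQ]; ring

end Forms

/-! ### Classification of ternary quadratic forms -/

section Classification

variable {K : Type*} [Field K]

theorem exists_inOrbitTQ_apply_zero_ne_zero {x : Fin 6 → K} (hx : x ≠ 0) :
    ∃ y, InOrbitTQ x y ∧ y 0 ≠ 0 := by
  by_contra! H
  have key (g : Matrix (Fin 3) (Fin 3) K) (hg : g.det ≠ 0) : qval x (g 0) = 0 := by
    simpa [formAct] using H _ (inOrbitTQ_iff.2 ⟨1, g, one_ne_zero, hg, rfl⟩)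
  have h0 := key !![1, 0, 0; 0, 1, 0; 0, 0, 1] (by simp [Matrix.det_fin_three])
  have h3 := key !![0, 1, 0; 1, 0, 0; 0, 0, 1] (by simp [Matrix.det_fin_three])
  have h5 := key !![0, 0, 1; 0, 1, 0; 1, 0, 0] (by simp [Matrix.det_fin_three])
  have h1 := key !![1, 1, 0; 0, 1, 0; 0, 0, 1] (by simp [Matrix.det_fin_three])
  have h2 := key !![1, 0, 1; 0, 1, 0; 0, 0, 1] (by simp [Matrix.det_fin_three])
  have h4 := key !![0, 1, 1; 1, 0, 0; 0, 0, 1] (by simp [Matrix.det_fin_three])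
  simp [qval] at h0 h1 h2 h3 h4 h5
  refine hx (funext fun i => ?_)
  fin_cases i <;> simp_all

theorem exists_inOrbitTQ_complete_square (h2 : (2 : K) ≠ 0) {x : Fin 6 → K} (hx : x 0 ≠ 0) :
    ∃ d e f, InOrbitTQ x ![1, 0, 0, d, e, f] := by
  let z := formAct (x 0)⁻¹ !![1, 0, 0; -x 1 / (2 * x 0), 1, 0; -x 2 / (2 * x 0), 0, 1] x
  have hz : z = ![1, 0, 0, z 3, z 4, z 5] := by
    ext i
    fin_cases i
    · simp [z, formAct, qval, hx]
    · simp [z, formAct, qpolar]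
      field_simp
      right; ring
    · simp [z, formAct, qpolar]
      field_simp
      right; ring
    all_goals rfl
  refine ⟨z 3, z 4, z 5, ?_⟩
  rw [← hz]
  exact inOrbitTQ_iff.2 ⟨_, _, inv_ne_zero hx, by simp [Matrix.det_fin_three], rfl⟩

theorem exists_inOrbitTQ_binary_ne_zero {d e f : K} (h : d ≠ 0 ∨ e ≠ 0 ∨ f ≠ 0) :
    ∃ d' e' f', d' ≠ 0 ∧ InOrbitTQ ![1, 0, 0, d, e, f] ![1, 0, 0, d', e', f'] := by
  by_cases hd : d = 0
  · by_cases hf : f = 0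
    · refine ⟨e, e, 0, by simp_all, inOrbitTQ_iff.2
        ⟨1, !![1, 0, 0; 0, 1, 1; 0, 0, 1], one_ne_zero, by simp [Matrix.det_fin_three], ?_⟩⟩
      ext i
      fin_cases i <;> simp [formAct, qval, qpolar, hd, hf]
    · refine ⟨f, e, d, hf, inOrbitTQ_iff.2
        ⟨1, !![1, 0, 0; 0, 0, 1; 0, 1, 0], one_ne_zero, by simp [Matrix.det_fin_three], ?_⟩⟩
      ext i
      fin_cases i <;> simp [formAct, qval, qpolar]
  · refine ⟨d, e, f, hd, inOrbitTQ_iff.2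
      ⟨1, 1, one_ne_zero, by simp, formAct_one _⟩⟩

theorem exists_inOrbitTQ_diagonal (h2 : (2 : K) ≠ 0) {d : K} (e f : K) (hd : d ≠ 0) :
    ∃ f', InOrbitTQ ![1, 0, 0, d, e, f] ![1, 0, 0, d, 0, f'] := by
  refine ⟨f - e ^ 2 / (4 * d), inOrbitTQ_iff.2
    ⟨1, !![1, 0, 0; 0, 1, 0; 0, -e / (2 * d), 1], one_ne_zero,
      by simp [Matrix.det_fin_three], ?_⟩⟩
  have h4 : (4 : K) ≠ 0 := by
    have : (4 : K) = 2 * 2 := by norm_num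
    simpa [this] using h2
  ext i
  fin_cases i <;> simp [formAct, qval, qpolar] <;> field_simp <;> ring

theorem inOrbitTQ_hyperbolic (h2 : (2 : K) ≠ 0) {s : K} (hs : s ≠ 0) :
    InOrbitTQ ![0, 1, 0, 0, 0, 0] ![1, 0, 0, -s ^ 2, 0, 0] := by
  refine inOrbitTQ_iff.2 ⟨1, !![1, 1, 0; -s, s, 0; 0, 0, 1], one_ne_zero, ?_, ?_⟩
  · have : s + s ≠ 0 := by rw [← two_mul]; exact mul_ne_zero h2 hs
    simpa [Matrix.det_fin_three] using this
  · ext i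
    fin_cases i <;> simp [formAct, qval, qpolar]
    ring

theorem inOrbitTQ_anisotropic (l : K) {s : K} (hs : s ≠ 0) :
    InOrbitTQ ![1, 0, 0, -l, 0, 0] ![1, 0, 0, -(l * s ^ 2), 0, 0] := by
  refine inOrbitTQ_iff.2 ⟨1, !![1, 0, 0; 0, s, 0; 0, 0, 1], one_ne_zero, ?_, ?_⟩
  · simpa [Matrix.det_fin_three] using hs
  · ext i
    fin_cases i <;> simp [formAct, qval, qpolar]

theorem inOrbitTQ_conic (h2 : (2 : K) ≠ 0) {d f a b : K} (hd : d ≠ 0) (hf : f ≠ 0)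
    (hab : d * a ^ 2 + (f * b ^ 2 + 1) = 0) :
    InOrbitTQ ![1, 0, 0, 0, -1, 0] ![1, 0, 0, d, 0, f] := by
  refine inOrbitTQ_iff.2 ⟨-(d * f),
    !![0, 1 / (d * f), 1; -b, -(d * a) / (d * f), d * a; a, -(f * b) / (d * f), f * b],
    by simp [hd, hf], ?_, ?_⟩
  · have : (!![0, 1 / (d * f), 1; -b, -(d * a) / (d * f), d * a;
        a, -(f * b) / (d * f), f * b] : Matrix (Fin 3) (Fin 3) K).det = -2 / (d * f) := by
      simp [Matrix.det_fin_three]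
      field_simp
      linear_combination 2 * hab
    rw [this]
    simp [h2, hd, hf]
  · ext i
    fin_cases i <;> simp [formAct, qval, qpolar] <;> field_simp
    · right; ring
    · right; ring
    · linear_combination -hab
    · right; ring
    · linear_combination -hab

end Classification

/-- Representatives of the five orbits of ternary quadratic forms. -/
def orbitRep {K : Type*} [Field K] (l : K) : Fin 5 → Fin 6 → K :=
  ![![0,0,0,0,0,0], ![1,0,0,0,0,0], ![0,1,0,0,0,0], ![1,0,0,-l,0,0], ![1,0,0,0,-1,0]]

theorem exists_mul_sq_add_mul_sq_add_one_eq_zero (h2 : ringChar F ≠ 2) {d f : F} (hd : d ≠ 0)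
    (hf : f ≠ 0) : ∃ a b : F, d * a ^ 2 + (f * b ^ 2 + 1) = 0 := by
  obtain ⟨a, b, h⟩ := FiniteField.exists_root_sum_quadratic
    (f := Polynomial.C d * Polynomial.X ^ 2) (g := Polynomial.C f * Polynomial.X ^ 2 + 1)
    (by compute_degree!) (by compute_degree!)
    (FiniteField.odd_card_of_char_ne_two h2)
  exact ⟨a, b, by simpa using h⟩

theorem exists_eq_mul_sq_of_not_isSquare {l d : F} (hl : ¬ IsSquare l) (hd : ¬ IsSquare d) :
    ∃ s ≠ 0, d = l * s ^ 2 := by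
  have hl0 : l ≠ 0 := fun h => hl (h ▸ IsSquare.zero)
  have hd0 : d ≠ 0 := fun h => hd (h ▸ IsSquare.zero)
  have : quadraticChar F (d * l) = 1 := by
    rw [map_mul, quadraticChar_neg_one_iff_not_isSquare.2 hl,
      quadraticChar_neg_one_iff_not_isSquare.2 hd]
    norm_num
  obtain ⟨s, hs⟩ := (quadraticChar_one_iff_isSquare (mul_ne_zero hd0 hl0)).1 this
  refine ⟨s / l, div_ne_zero ?_ hl0, ?_⟩
  · rintro rfl
    simp [hd0, hl0] at hs
  · field_simp
    linear_combination hs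

theorem exists_inOrbitTQ_orbitRep (h2 : ringChar F ≠ 2) {l : F} (hl : ¬ IsSquare l)
    (x : Fin 6 → F) : ∃ i, InOrbitTQ (orbitRep l i) x := by
  have h20 : (2 : F) ≠ 0 := Ring.two_ne_zero h2
  by_cases hx : x = 0
  · refine ⟨0, inOrbitTQ_iff.2 ⟨1, 1, one_ne_zero, by simp, ?_⟩⟩
    rw [formAct_one, hx]
    ext i
    fin_cases i <;> rfl
  obtain ⟨y, hxy, hy⟩ := exists_inOrbitTQ_apply_zero_ne_zero hx
  obtain ⟨d, e, f, hyz⟩ := exists_inOrbitTQ_complete_square h20 hy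
  replace hxy := inOrbitTQ_symm (inOrbitTQ_trans hxy hyz)
  by_cases h : d ≠ 0 ∨ e ≠ 0 ∨ f ≠ 0
  · obtain ⟨d, e, f, hd, hz⟩ := exists_inOrbitTQ_binary_ne_zero h
    obtain ⟨f, hw⟩ := exists_inOrbitTQ_diagonal h20 e f hd
    replace hxy := inOrbitTQ_trans (inOrbitTQ_symm (inOrbitTQ_trans hz hw)) hxy
    by_cases hf : f = 0
    · subst hf
      by_cases hs : IsSquare (-d)
      · obtain ⟨s, hs⟩ := hs
        obtain rfl : d = -s ^ 2 := by linear_combination -hs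
        refine ⟨2, inOrbitTQ_trans (inOrbitTQ_hyperbolic h20 ?_) hxy⟩
        rintro rfl
        simp at hd
      · obtain ⟨s, hs0, hs⟩ := exists_eq_mul_sq_of_not_isSquare hl hs
        obtain rfl : d = -(l * s ^ 2) := by linear_combination -hs
        exact ⟨3, inOrbitTQ_trans (inOrbitTQ_anisotropic l hs0) hxy⟩
    · obtain ⟨a, b, hab⟩ := exists_mul_sq_add_mul_sq_add_one_eq_zero h2 hd hf
      exact ⟨4, inOrbitTQ_trans (inOrbitTQ_conic h20 hd hf hab) hxy⟩
  · push Not at h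
    obtain ⟨rfl, rfl, rfl⟩ := h
    exact ⟨1, hxy⟩

/-! ### Pencils spanned by products of two linear forms -/

section Pencil

/-- The form `k₀ a² + k₁ a b + k₂ b²`, where `a` and `b` are linear forms. -/
def pencil {K : Type*} [Field K] (k : Fin 3 → K) (a b : Fin 3 → K) : Fin 6 → K :=
  k 0 • linProd a a + k 1 • linProd a b + k 2 • linProd b b

/-- The scaled form `t (k₀ a² + k₁ a b + k₂ b²)` with parameter `(t, a, b)`. -/
def pencilForm {K : Type*} [Field K] (k : Fin 3 → K) (P : Kˣ × (Fin 3 → K) × (Fin 3 → K)) :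
    Fin 6 → K :=
  (P.1 : K) • pencil k P.2.1 P.2.2

/-- The number of parameters at which `pencilForm k` takes the value `x`. -/
def pencilCount (k : Fin 3 → F) (x : Fin 6 → F) : ℕ :=
  (Finset.univ.filter fun P => pencilForm k P = x).card

/-- The sum of `ψ [x, y]` over all values `x` of `pencilForm k`, with multiplicity. -/
def pencilSum (ψ : AddChar F ℂ) (k : Fin 3 → F) (y : Fin 6 → F) : ℂ :=
  ∑ P, ψ (bformTQ (pencilForm k P) y)

theorem pencilSum_eq_sum_pencilCount (ψ : AddChar F ℂ) (k : Fin 3 → F) (y : Fin 6 → F) :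
    pencilSum ψ k y = ∑ x, (pencilCount k x : ℂ) * ψ (bformTQ x y) := by
  rw [pencilSum, ← Finset.sum_fiberwise Finset.univ (pencilForm k)]
  refine Finset.sum_congr rfl fun x _ => ?_
  rw [pencilCount, ← nsmul_eq_mul, ← Finset.sum_const]
  refine Finset.sum_congr rfl fun P hP => ?_
  rw [(Finset.mem_filter.1 hP).2]

theorem formAct_pencilForm {K : Type*} [Field K] (s : Kˣ) (g : Matrix (Fin 3) (Fin 3) K)
    (k : Fin 3 → K) (P : Kˣ × (Fin 3 → K) × (Fin 3 → K)) :
    formAct (s : K) g (pencilForm k P) = pencilForm k (s * P.1, g *ᵥ P.2.1, g *ᵥ P.2.2) := by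
  simp only [pencilForm, pencil, formAct_smul, formAct_add, linProd_mulVec, Units.val_mul,
    smul_add, smul_smul]
  ext i
  simp only [Pi.add_apply, Pi.smul_apply, smul_eq_mul]
  ring

theorem bformTQ_pencilForm_formAct {K : Type*} [Field K] (h2 : (2 : K) ≠ 0) (s : Kˣ)
    (g : Matrix (Fin 3) (Fin 3) K) (k : Fin 3 → K) (P : Kˣ × (Fin 3 → K) × (Fin 3 → K))
    (y : Fin 6 → K) :
    bformTQ (pencilForm k P) (formAct (s : K) g y) =
      bformTQ (pencilForm k (s * P.1, P.2.1 ᵥ* g, P.2.2 ᵥ* g)) y := by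
  simp only [pencilForm, pencil, bformTQ_smul_left, bformTQ_add_left,
    bformTQ_linProd_formAct h2, Units.val_mul]
  ring

theorem pencilCount_le_of_inOrbitTQ {k : Fin 3 → F} {x y : Fin 6 → F} (h : InOrbitTQ x y) :
    pencilCount k x ≤ pencilCount k y := by
  obtain ⟨s, g, hs, hg, rfl⟩ := inOrbitTQ_iff.1 h
  lift s to Fˣ using hs.isUnit
  have inj := Matrix.mulVec_injective_of_isUnit
    ((Matrix.isUnit_iff_isUnit_det g).2 (isUnit_iff_ne_zero.2 hg))
  refine Finset.card_le_card_of_injOn (fun P => (s * P.1, g *ᵥ P.2.1, g *ᵥ P.2.2)) ?_ ?_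
  · intro P hP
    simp only [Finset.coe_filter, Finset.mem_univ, true_and, Set.mem_ofPred_eq] at hP ⊢
    rw [← hP, formAct_pencilForm]
  · rintro ⟨t, a, b⟩ - ⟨t', a', b'⟩ - hP
    simp only [Prod.mk.injEq, mul_right_inj] at hP ⊢
    exact ⟨hP.1, inj hP.2.1, inj hP.2.2⟩

theorem pencilCount_eq_of_inOrbitTQ {k : Fin 3 → F} {x y : Fin 6 → F} (h : InOrbitTQ x y) :
    pencilCount k x = pencilCount k y :=
  (pencilCount_le_of_inOrbitTQ h).antisymm (pencilCount_le_of_inOrbitTQ (inOrbitTQ_symm h))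

theorem pencilSum_eq_of_inOrbitTQ (h2 : (2 : F) ≠ 0) (ψ : AddChar F ℂ) {k : Fin 3 → F}
    {x y : Fin 6 → F} (h : InOrbitTQ x y) : pencilSum ψ k y = pencilSum ψ k x := by
  obtain ⟨s, g, hs, hg, rfl⟩ := inOrbitTQ_iff.1 h
  lift s to Fˣ using hs.isUnit
  have inj := Matrix.vecMul_injective_of_isUnit
    ((Matrix.isUnit_iff_isUnit_det g).2 (isUnit_iff_ne_zero.2 hg))
  have bij : Function.Bijective fun P : Fˣ × (Fin 3 → F) × (Fin 3 → F) =>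
      (s * P.1, P.2.1 ᵥ* g, P.2.2 ᵥ* g) := by
    refine Finite.injective_iff_bijective.1 ?_
    rintro ⟨t, a, b⟩ ⟨t', a', b'⟩ hP
    simp only [Prod.mk.injEq, mul_right_inj] at hP ⊢
    exact ⟨hP.1, inj hP.2.1, inj hP.2.2⟩
  simp only [pencilSum, bformTQ_pencilForm_formAct h2]
  exact bij.sum_comp fun P => ψ (bformTQ (pencilForm k P) x)

end Pencil

/-! ### Counting parameters over the orbit representatives -/

section Count

theorem pencilCount_eq_card {β : Type*} [Fintype β] {k : Fin 3 → F} {x : Fin 6 → F}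
    (φ : β → Fˣ × (Fin 3 → F) × (Fin 3 → F)) (inj : Function.Injective φ)
    (h : ∀ P, pencilForm k P = x ↔ ∃ c, φ c = P) : pencilCount k x = Fintype.card β := by
  rw [pencilCount, ← Finset.card_univ, ← Finset.card_image_of_injective _ inj]
  congr 1
  ext P
  simp [h]

theorem pencilCount_eq_zero {k : Fin 3 → F} {x : Fin 6 → F} (h : ∀ P, pencilForm k P ≠ x) :
    pencilCount k x = 0 := by
  simp [pencilCount, h]

theorem pencilForm_eq_iff {K : Type*} [Field K] (k a b : Fin 3 → K) (t : Kˣ) (x : Fin 6 → K) :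
    pencilForm k (t, a, b) = x ↔
      t * (k 0 * a 0 ^ 2 + k 1 * (a 0 * b 0) + k 2 * b 0 ^ 2) = x 0 ∧
      t * (2 * k 0 * a 0 * a 1 + k 1 * (a 0 * b 1 + a 1 * b 0) + 2 * k 2 * b 0 * b 1) = x 1 ∧
      t * (2 * k 0 * a 0 * a 2 + k 1 * (a 0 * b 2 + a 2 * b 0) + 2 * k 2 * b 0 * b 2) = x 2 ∧
      t * (k 0 * a 1 ^ 2 + k 1 * (a 1 * b 1) + k 2 * b 1 ^ 2) = x 3 ∧
      t * (2 * k 0 * a 1 * a 2 + k 1 * (a 1 * b 2 + a 2 * b 1) + 2 * k 2 * b 1 * b 2) = x 4 ∧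
      t * (k 0 * a 2 ^ 2 + k 1 * (a 2 * b 2) + k 2 * b 2 ^ 2) = x 5 := by
  have h : pencilForm k (t, a, b) =
      ![t * (k 0 * a 0 ^ 2 + k 1 * (a 0 * b 0) + k 2 * b 0 ^ 2),
        t * (2 * k 0 * a 0 * a 1 + k 1 * (a 0 * b 1 + a 1 * b 0) + 2 * k 2 * b 0 * b 1),
        t * (2 * k 0 * a 0 * a 2 + k 1 * (a 0 * b 2 + a 2 * b 0) + 2 * k 2 * b 0 * b 2),
        t * (k 0 * a 1 ^ 2 + k 1 * (a 1 * b 1) + k 2 * b 1 ^ 2),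
        t * (2 * k 0 * a 1 * a 2 + k 1 * (a 1 * b 2 + a 2 * b 1) + 2 * k 2 * b 1 * b 2),
        t * (k 0 * a 2 ^ 2 + k 1 * (a 2 * b 2) + k 2 * b 2 ^ 2)] := by
    ext i
    fin_cases i <;> simp [pencilForm, pencil, linProd] <;> ring
  rw [h]
  constructor
  · rintro rfl
    simp
  · rintro ⟨h0, h1, h2, h3, h4, h5⟩
    ext i
    fin_cases i <;> assumption

theorem sq_sub_mul_sq_eq_zero {K : Type*} [Field K] {l : K} (hl : ¬ IsSquare l) {a b : K}
    (h : a ^ 2 - l * b ^ 2 = 0) : a = 0 ∧ b = 0 := by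
  have hb : b = 0 := by
    by_contra hb
    refine hl ⟨a / b, ?_⟩
    field_simp
    linear_combination -h
  subst hb
  simpa using h

variable (F) in
theorem card_units_add_one : Fintype.card Fˣ + 1 = Fintype.card F := by
  rw [Fintype.card_units]
  exact Nat.sub_add_cancel Fintype.card_pos

theorem card_ne_zero_add_one (α : Type*) [Fintype α] [Zero α] :
    Fintype.card {a : α // a ≠ 0} + 1 = Fintype.card α := by
  rw [Fintype.card_subtype_compl, Fintype.card_subtype_eq]
  exact Nat.sub_add_cancel Fintype.card_pos

theorem eq_zero_of_apply {K : Type*} [Zero K] {a : Fin 3 → K} (h0 : a 0 = 0) (h1 : a 1 = 0)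
    (h2 : a 2 = 0) : a = 0 := by
  ext i
  fin_cases i <;> assumption

theorem vec_eq_of_apply {K : Type*} {a : Fin 3 → K} {x y z : K} (h0 : a 0 = x) (h1 : a 1 = y)
    (h2 : a 2 = z) : ![x, y, z] = a := by
  ext i
  fin_cases i <;> exact Eq.symm (by assumption)

theorem pencilCount_sq_zero :
    pencilCount ![1, 0, 0] (0 : Fin 6 → F) = Fintype.card Fˣ * Fintype.card F ^ 3 := by
  rw [pencilCount_eq_card (β := Fˣ × (Fin 3 → F)) fun c => (c.1, 0, c.2)]
  · simp
  · rintro ⟨t, b⟩ ⟨t', b'⟩ h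
    simpa using h
  · rintro ⟨t, a, b⟩
    rw [pencilForm_eq_iff]
    constructor
    · simp only [Matrix.cons_val, Pi.zero_apply]
      rintro ⟨h0, -, -, h1, -, h2⟩
      simp at h0 h1 h2
      exact ⟨(t, b), by rw [eq_zero_of_apply h0 h1 h2]⟩
    · rintro ⟨⟨c, d⟩, h⟩
      simp only [Prod.mk.injEq] at h
      simp [← h.2.1]

theorem pencilCount_sq_sq :
    pencilCount ![1, 0, 0] ![(1 : F), 0, 0, 0, 0, 0] = Fintype.card Fˣ * Fintype.card F ^ 3 := by
  rw [pencilCount_eq_card (β := Fˣ × (Fin 3 → F)) fun c => (c.1⁻¹ ^ 2, ![(c.1 : F), 0, 0], c.2)]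
  · simp
  · rintro ⟨t, b⟩ ⟨t', b'⟩ h
    simp at h
    ext <;> simp [h]
  · rintro ⟨t, a, b⟩
    rw [pencilForm_eq_iff]
    constructor
    · rintro ⟨h0, -, -, h1, -, h2⟩
      simp at h0 h1 h2
      have ha : a 0 ≠ 0 := by rintro h; simp [h] at h0
      refine ⟨(Units.mk0 (a 0) ha, b), Prod.ext (Units.ext ?_)
        (Prod.ext (vec_eq_of_apply rfl h1 h2) rfl)⟩
      simp
      field_simp
      linear_combination -h0
    · rintro ⟨⟨c, d⟩, h⟩
      simp only [Prod.mk.injEq] at h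
      simp [← h.1, ← h.2.1]

theorem linProd_eq_zero_iff {K : Type*} [Field K] {a b : Fin 3 → K} :
    linProd a b = 0 ↔ a = 0 ∨ b = 0 := by
  constructor
  · intro h
    have h (i : Fin 6) : linProd a b i = 0 := congrFun h i
    have h0 := h 0
    have h1 := h 1
    have h2 := h 2
    have h3 := h 3
    have h4 := h 4
    have h5 := h 5
    simp [linProd] at h0 h1 h2 h3 h4 h5
    have key : (a 0 = 0 ∧ a 1 = 0 ∧ a 2 = 0) ∨ (b 0 = 0 ∧ b 1 = 0 ∧ b 2 = 0) := by grind
    exact key.imp (fun h => eq_zero_of_apply h.1 h.2.1 h.2.2)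
      fun h => eq_zero_of_apply h.1 h.2.1 h.2.2
  · rintro (rfl | rfl) <;> ext i <;> fin_cases i <;> simp [linProd]

theorem pencilCount_mul_zero :
    pencilCount ![0, 1, 0] (0 : Fin 6 → F) =
      Fintype.card Fˣ * (Fintype.card F ^ 3 + Fintype.card {a : Fin 3 → F // a ≠ 0}) := by
  rw [pencilCount_eq_card (β := Fˣ × ((Fin 3 → F) ⊕ {a : Fin 3 → F // a ≠ 0}))
    fun c => (c.1, Sum.elim (fun a => (a, 0)) (fun b => (0, b.1)) c.2)]
  · simp
  · rintro ⟨t, b | b⟩ ⟨t', b' | b'⟩ h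
    · simpa using h
    · simp at h
      exact absurd h.2.2.symm b'.2
    · simp at h
      exact absurd h.2.2 b.2
    · simpa [Subtype.ext_iff] using h
  · rintro ⟨t, a, b⟩
    have h : pencilForm ![0, 1, 0] (t, a, b) = 0 ↔ a = 0 ∨ b = 0 := by
      simp [pencilForm, pencil, linProd_eq_zero_iff]
    rw [h]
    constructor
    · by_cases hb : b = 0
      · rintro -
        exact ⟨(t, Sum.inl a), by simp [hb]⟩
      · intro h
        exact ⟨(t, Sum.inr ⟨b, hb⟩), by simp [h.resolve_right hb]⟩
    · rintro ⟨⟨c, d | d⟩, h⟩ <;> simp at h <;> simp [← h.2.1, ← h.2.2]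

theorem pencilCount_mul_sq :
    pencilCount ![0, 1, 0] ![(1 : F), 0, 0, 0, 0, 0] = Fintype.card Fˣ * Fintype.card Fˣ := by
  rw [pencilCount_eq_card (β := Fˣ × Fˣ)
    fun c => ((c.1 * c.2)⁻¹, ![(c.1 : F), 0, 0], ![(c.2 : F), 0, 0])]
  · simp
  · rintro ⟨t, b⟩ ⟨t', b'⟩ h
    simp [← Units.ext_iff] at h
    simp [h]
  · rintro ⟨t, a, b⟩
    rw [pencilForm_eq_iff]
    constructor
    · rintro ⟨h0, h1, h2, h3, -, h5⟩
      simp at h0 h1 h2 h3 h5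
      have ha : a 0 ≠ 0 := by rintro h; simp [h] at h0
      have hb : b 0 ≠ 0 := by rintro h; simp [h] at h0
      have e1 : a 1 = 0 ∧ b 1 = 0 := by grind
      have e2 : a 2 = 0 ∧ b 2 = 0 := by grind
      refine ⟨(Units.mk0 (a 0) ha, Units.mk0 (b 0) hb), Prod.ext (Units.ext ?_)
        (Prod.ext (vec_eq_of_apply rfl e1.1 e2.1) (vec_eq_of_apply rfl e1.2 e2.2))⟩
      simp
      field_simp
      linear_combination -h0
    · rintro ⟨⟨c, d⟩, h⟩
      simp only [Prod.mk.injEq] at h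
      simp [← h.1, ← h.2.1, ← h.2.2]
      field_simp

theorem pencilCount_mul_mul :
    pencilCount ![0, 1, 0] ![(0 : F), 1, 0, 0, 0, 0] =
      2 * (Fintype.card Fˣ * Fintype.card Fˣ) := by
  rw [pencilCount_eq_card (β := Bool × Fˣ × Fˣ) fun c => ((c.2.1 * c.2.2)⁻¹,
    if c.1 then (![(c.2.1 : F), 0, 0], ![0, (c.2.2 : F), 0])
    else (![0, (c.2.1 : F), 0], ![(c.2.2 : F), 0, 0]))]
  · simp
  · rintro ⟨s, t, b⟩ ⟨s', t', b'⟩ h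
    cases s <;> cases s' <;> simp [← Units.ext_iff] at h ⊢ <;> simp [h]
  · rintro ⟨t, a, b⟩
    rw [pencilForm_eq_iff]
    constructor
    · rintro ⟨h0, h1, h2, h3, h4, h5⟩
      simp at h0 h1 h2 h3 h4 h5
      rcases h0 with ha | hb
      · have ha1 : a 1 ≠ 0 := by rintro h; simp [h, ha] at h1
        have hb0 : b 0 ≠ 0 := by rintro h; simp [h, ha] at h1
        have e2 : a 2 = 0 ∧ b 2 = 0 := by grind
        refine ⟨(false, Units.mk0 (a 1) ha1, Units.mk0 (b 0) hb0), Prod.ext (Units.ext ?_)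
          (Prod.ext (vec_eq_of_apply ha rfl e2.1) (vec_eq_of_apply rfl (by grind) e2.2))⟩
        simp
        field_simp
        simp [ha] at h1
        linear_combination -h1
      · have ha0 : a 0 ≠ 0 := by rintro h; simp [h, hb] at h1
        have hb1 : b 1 ≠ 0 := by rintro h; simp [h, hb] at h1
        have e2 : a 2 = 0 ∧ b 2 = 0 := by grind
        refine ⟨(true, Units.mk0 (a 0) ha0, Units.mk0 (b 1) hb1), Prod.ext (Units.ext ?_)
          (Prod.ext (vec_eq_of_apply rfl (by grind) e2.1) (vec_eq_of_apply hb rfl e2.2))⟩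
        simp
        field_simp
        simp [hb] at h1
        linear_combination -h1
    · rintro ⟨⟨_ | _, c, d⟩, h⟩ <;> simp only [Prod.mk.injEq] at h <;>
        obtain ⟨rfl, h⟩ := h <;> simp at h <;> simp [← h.1, ← h.2] <;> field_simp

theorem pencilCount_norm_zero {l : F} (hl : ¬ IsSquare l) :
    pencilCount ![1, 0, -l] (0 : Fin 6 → F) = Fintype.card Fˣ := by
  rw [pencilCount_eq_card (β := Fˣ) fun c => (c, 0, 0)]
  · intro s t h
    simpa using h
  · rintro ⟨t, a, b⟩
    rw [pencilForm_eq_iff]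
    constructor
    · rintro ⟨h0, -, -, h1, -, h2⟩
      simp [← sub_eq_add_neg] at h0 h1 h2
      have e0 := sq_sub_mul_sq_eq_zero hl h0
      have e1 := sq_sub_mul_sq_eq_zero hl h1
      have e2 := sq_sub_mul_sq_eq_zero hl h2
      exact ⟨t, by rw [eq_zero_of_apply e0.1 e1.1 e2.1, eq_zero_of_apply e0.2 e1.2 e2.2]⟩
    · rintro ⟨c, h⟩
      simp only [Prod.mk.injEq] at h
      simp [← h.2.1, ← h.2.2]

theorem pencilCount_norm_sq {l : F} (hl : ¬ IsSquare l) :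
    pencilCount ![1, 0, -l] ![(1 : F), 0, 0, 0, 0, 0] =
      Fintype.card {x : F × F // x ≠ 0} := by
  have hN (x : {x : F × F // x ≠ 0}) : x.1.1 ^ 2 - l * x.1.2 ^ 2 ≠ 0 := fun h =>
    x.2 (Prod.ext_iff.2 (sq_sub_mul_sq_eq_zero hl h))
  rw [pencilCount_eq_card (β := {x : F × F // x ≠ 0})
    fun x => ((Units.mk0 _ (hN x))⁻¹, ![x.1.1, 0, 0], ![x.1.2, 0, 0])]
  · rintro ⟨⟨x, y⟩, h⟩ ⟨⟨x', y'⟩, h'⟩ h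
    simp at h
    simp [h]
  · rintro ⟨t, a, b⟩
    rw [pencilForm_eq_iff]
    constructor
    · rintro ⟨h0, -, -, h1, -, h2⟩
      simp [← sub_eq_add_neg] at h0 h1 h2
      have e1 := sq_sub_mul_sq_eq_zero hl h1
      have e2 := sq_sub_mul_sq_eq_zero hl h2
      refine ⟨⟨(a 0, b 0), ?_⟩, Prod.ext (Units.ext ?_)
        (Prod.ext (vec_eq_of_apply rfl e1.1 e2.1) (vec_eq_of_apply rfl e1.2 e2.2))⟩
      · intro h
        simp at h
        simp [h] at h0
      · simpa using inv_eq_of_mul_eq_one_left h0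
    · rintro ⟨x, h⟩
      simp only [Prod.mk.injEq] at h
      have := hN x
      simp [← h.1, ← h.2.1, ← h.2.2, ← sub_eq_add_neg, this]

theorem eq_or_eq_neg_of_norm {K : Type*} [Field K] {l t x y z w : K} (hl : l ≠ 0)
    (h : t * (x ^ 2 - l * y ^ 2) = 1) (h' : x * z = l * y * w)
    (h'' : t * (z ^ 2 - l * w ^ 2) = -l) :
    z = l * y ∧ w = x ∨ z = -(l * y) ∧ w = -x := by
  have hw : w ^ 2 = x ^ 2 := by
    refine mul_left_cancel₀ hl ?_
    linear_combination -x ^ 2 * h'' - l * w ^ 2 * h + t * (x * z + l * y * w) * h'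
  rcases eq_or_ne x 0 with rfl | hx
  · have hw : w = 0 := by simpa using hw
    subst hw
    have hz : z ^ 2 = (l * y) ^ 2 := by
      linear_combination -z ^ 2 * h - l * y ^ 2 * h''
    simpa using sq_eq_sq_iff_eq_or_eq_neg.1 hz
  · rcases sq_eq_sq_iff_eq_or_eq_neg.1 hw with rfl | rfl
    · exact Or.inl ⟨mul_left_cancel₀ hx (by linear_combination h'), rfl⟩
    · exact Or.inr ⟨mul_left_cancel₀ hx (by linear_combination h'), rfl⟩

theorem pencilCount_norm_norm (h2 : (2 : F) ≠ 0) {l : F} (hl : ¬ IsSquare l) :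
    pencilCount ![1, 0, -l] ![1, 0, 0, -l, 0, 0] =
      2 * Fintype.card {x : F × F // x ≠ 0} := by
  have hl0 : l ≠ 0 := fun h => hl (h ▸ IsSquare.zero)
  have hN (x : {x : F × F // x ≠ 0}) : x.1.1 ^ 2 - l * x.1.2 ^ 2 ≠ 0 := fun h =>
    x.2 (Prod.ext_iff.2 (sq_sub_mul_sq_eq_zero hl h))
  rw [pencilCount_eq_card (β := Bool × {x : F × F // x ≠ 0})
    fun x => ((Units.mk0 _ (hN x.2))⁻¹,
      if x.1 then (![x.2.1.1, l * x.2.1.2, 0], ![x.2.1.2, x.2.1.1, 0])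
      else (![x.2.1.1, -(l * x.2.1.2), 0], ![x.2.1.2, -x.2.1.1, 0]))]
  · simp
  · have hneg (x : F) : x = -x ↔ x = 0 := by
      rw [eq_neg_iff_add_eq_zero, ← two_mul, mul_eq_zero, or_iff_right h2]
    rintro ⟨s, ⟨x, y⟩, h⟩ ⟨s', ⟨x', y'⟩, h'⟩ e
    have e := congrArg Prod.snd e
    cases s <;> cases s' <;> simp at e ⊢ <;> obtain ⟨⟨rfl, e⟩, rfl, e'⟩ := e <;>
      simp [hneg, eq_comm, hl0, Prod.ext_iff] at e e' h ⊢ <;> grind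
  · rintro ⟨t, a, b⟩
    rw [pencilForm_eq_iff]
    constructor
    · rintro ⟨h0, h1, -, h3, -, h5⟩
      simp [← sub_eq_add_neg] at h0 h1 h3 h5
      have e2 := sq_sub_mul_sq_eq_zero hl h5
      have hx : (a 0, b 0) ≠ 0 := by
        intro h
        simp at h
        simp [h] at h0
      rcases eq_or_eq_neg_of_norm hl0 h0 (mul_left_cancel₀ h2 (by linear_combination h1)) h3
        with h | h
      · exact ⟨(true, ⟨_, hx⟩), Prod.ext (Units.ext (by simpa using inv_eq_of_mul_eq_one_left h0))
          (Prod.ext (vec_eq_of_apply rfl h.1 e2.1) (vec_eq_of_apply rfl h.2 e2.2))⟩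
      · exact ⟨(false, ⟨_, hx⟩), Prod.ext (Units.ext (by simpa using inv_eq_of_mul_eq_one_left h0))
          (Prod.ext (vec_eq_of_apply rfl h.1 e2.1) (vec_eq_of_apply rfl h.2 e2.2))⟩
    · rintro ⟨⟨s, x⟩, h⟩
      have := hN x
      cases s <;> simp only [Prod.mk.injEq] at h <;> obtain ⟨rfl, h⟩ := h <;> simp at h <;>
        simp [← h.1, ← h.2, ← sub_eq_add_neg, this] <;> field_simp <;> ring_nf <;> simp

theorem pencilCount_sq_mul : pencilCount ![1, 0, 0] ![(0 : F), 1, 0, 0, 0, 0] = 0 := by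
  refine pencilCount_eq_zero fun ⟨t, a, b⟩ h => ?_
  obtain ⟨h0, h1, -, -, -, -⟩ := (pencilForm_eq_iff ..).1 h
  simp at h0 h1
  simp [h0] at h1

theorem pencilCount_sq_norm {l : F} (h2 : (2 : F) ≠ 0) (hl : ¬ IsSquare l) :
    pencilCount ![1, 0, 0] ![1, 0, 0, -l, 0, 0] = 0 := by
  refine pencilCount_eq_zero fun ⟨t, a, b⟩ h => ?_
  obtain ⟨h0, h1, -, h3, -, -⟩ := (pencilForm_eq_iff ..).1 h
  simp [h2] at h0 h1 h3
  rcases h1 with h1 | h1 <;> simp [h1] at h0 h3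
  exact hl (h3 ▸ IsSquare.zero)

theorem pencilCount_sq_conic :
    pencilCount ![1, 0, 0] ![(1 : F), 0, 0, 0, -1, 0] = 0 := by
  refine pencilCount_eq_zero fun ⟨t, a, b⟩ h => ?_
  obtain ⟨-, -, -, h3, h4, -⟩ := (pencilForm_eq_iff ..).1 h
  simp at h3 h4
  simp [h3] at h4

theorem pencilCount_mul_norm {l : F} (hl : ¬ IsSquare l) :
    pencilCount ![0, 1, 0] ![1, 0, 0, -l, 0, 0] = 0 := by
  refine pencilCount_eq_zero fun ⟨t, a, b⟩ h => ?_
  obtain ⟨h0, h1, -, h3, -, -⟩ := (pencilForm_eq_iff ..).1 h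
  simp at h0 h1 h3
  have ha : a 0 ≠ 0 := by rintro h; simp [h] at h0
  refine hl ⟨a 1 / a 0, ?_⟩
  field_simp
  linear_combination a 0 ^ 2 * h3 - t * a 0 * a 1 * h1 + a 1 ^ 2 * h0

theorem pencilCount_mul_conic :
    pencilCount ![0, 1, 0] ![(1 : F), 0, 0, 0, -1, 0] = 0 := by
  refine pencilCount_eq_zero fun ⟨t, a, b⟩ h => ?_
  obtain ⟨h0, h1, -, h3, h4, -⟩ := (pencilForm_eq_iff ..).1 h
  simp at h0 h1 h3 h4
  grind

theorem pencilCount_norm_mul {l : F} (hl : ¬ IsSquare l) :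
    pencilCount ![1, 0, -l] ![0, 1, 0, 0, 0, 0] = 0 := by
  refine pencilCount_eq_zero fun ⟨t, a, b⟩ h => ?_
  obtain ⟨h0, h1, -, -, -, -⟩ := (pencilForm_eq_iff ..).1 h
  simp [← sub_eq_add_neg] at h0 h1
  simp [sq_sub_mul_sq_eq_zero hl h0] at h1

theorem pencilCount_norm_conic {l : F} (hl : ¬ IsSquare l) :
    pencilCount ![1, 0, -l] ![1, 0, 0, 0, -1, 0] = 0 := by
  refine pencilCount_eq_zero fun ⟨t, a, b⟩ h => ?_
  obtain ⟨-, -, -, h3, h4, -⟩ := (pencilForm_eq_iff ..).1 h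
  simp [← sub_eq_add_neg] at h3 h4
  simp [sq_sub_mul_sq_eq_zero hl h3] at h4

end Count

/-! ### Character sums over pencils at the orbit representatives -/

section PencilSum

variable {ψ : AddChar F ℂ}

theorem sum_char_smul_mul_mul (hψ : ψ.IsPrimitive) {m : F} (hm : m ≠ 0) (t : Fˣ) :
    ∑ x : F × F, ψ (t * (m * (x.1 * x.2))) = Fintype.card F := by
  simpa [mul_assoc] using sum_char_mul_mul hψ (mul_ne_zero t.ne_zero hm)

theorem sum_char_smul_norm (hψ : ψ.IsPrimitive) (h2 : ringChar F ≠ 2) {l : F}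
    (hl : ¬ IsSquare l) {m : F} (hm : m ≠ 0) (t : Fˣ) :
    ∑ x : F × F, ψ (t * (m * (x.1 ^ 2 - l * x.2 ^ 2))) = -Fintype.card F := by
  simpa only [mul_assoc] using sum_char_norm hψ h2 hl (mul_ne_zero t.ne_zero hm)

theorem sum_char_zero (ψ : AddChar F ℂ) (t : Fˣ) :
    ∑ _x : F × F, ψ (t * 0) = (Fintype.card F : ℂ) ^ 2 := by
  simp [sq]

/-- The coordinates of two linear forms, listed in the order prescribed by `σ`. -/
def pairing {α : Type*} (σ : Fin 6 → Fin 6) (x : (α × α) × (α × α) × (α × α)) :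
    (Fin 3 → α) × (Fin 3 → α) :=
  let v := ![x.1.1, x.1.2, x.2.1.1, x.2.1.2, x.2.2.1, x.2.2.2]
  (![v (σ 0), v (σ 1), v (σ 2)], ![v (σ 3), v (σ 4), v (σ 5)])

theorem pairing_bijective {α : Type*} [Fintype α] {σ : Fin 6 → Fin 6} (hσ : σ.Injective) :
    Function.Bijective (pairing σ : (α × α) × (α × α) × (α × α) → _) := by
  refine (Fintype.bijective_iff_injective_and_card _).2 ⟨fun x y h => ?_, ?_⟩
  · have hv : ![x.1.1, x.1.2, x.2.1.1, x.2.1.2, x.2.2.1, x.2.2.2] =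
        ![y.1.1, y.1.2, y.2.1.1, y.2.1.2, y.2.2.1, y.2.2.2] := by
      refine (Finite.surjective_of_injective hσ).injective_comp_right (funext fun i => ?_)
      simp only [pairing, Prod.mk.injEq] at h
      fin_cases i
      exacts [congrFun h.1 0, congrFun h.1 1, congrFun h.1 2, congrFun h.2 0, congrFun h.2 1,
        congrFun h.2 2]
    ext
    exacts [congrFun hv 0, congrFun hv 1, congrFun hv 2, congrFun hv 3, congrFun hv 4,
      congrFun hv 5]
  · simp
    ring

theorem pencilSum_eq_sum_mul {k : Fin 3 → F} {y : Fin 6 → F} {A B C : F × F → F}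
    (σ : Fin 6 → Fin 6) (hσ : σ.Injective)
    (h : ∀ x, bformTQ (pencil k (pairing σ x).1 (pairing σ x).2) y = A x.1 + B x.2.1 + C x.2.2) :
    pencilSum ψ k y = ∑ t : Fˣ, (∑ x, ψ (t * A x)) * (∑ x, ψ (t * B x)) * ∑ x, ψ (t * C x) := by
  rw [pencilSum, Fintype.sum_prod_type]
  refine Finset.sum_congr rfl fun t _ => ?_
  rw [← (pairing_bijective hσ).sum_comp, Fintype.sum_prod_type, mul_assoc, Finset.sum_mul]
  refine Finset.sum_congr rfl fun a _ => ?_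
  rw [Fintype.sum_prod_type, Finset.sum_mul_sum, Finset.mul_sum]
  refine Finset.sum_congr rfl fun b _ => ?_
  rw [Finset.mul_sum]
  refine Finset.sum_congr rfl fun c _ => ?_
  rw [pencilForm, bformTQ_smul_left, h, ← AddChar.map_add_eq_mul, ← AddChar.map_add_eq_mul]
  congr 1
  ring

theorem pencilSum_eq_mul {k : Fin 3 → F} {y : Fin 6 → F} {A B C : F × F → F} {a b c : ℂ}
    (hA : ∀ t : Fˣ, ∑ x, ψ (t * A x) = a) (hB : ∀ t : Fˣ, ∑ x, ψ (t * B x) = b)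
    (hC : ∀ t : Fˣ, ∑ x, ψ (t * C x) = c) (σ : Fin 6 → Fin 6) (hσ : σ.Injective)
    (h : ∀ x, bformTQ (pencil k (pairing σ x).1 (pairing σ x).2) y = A x.1 + B x.2.1 + C x.2.2) :
    pencilSum ψ k y = Fintype.card Fˣ * (a * b * c) := by
  simp [pencilSum_eq_sum_mul σ hσ h, hA, hB, hC]

theorem pencilSum_eq_zero (hψ : ψ.IsPrimitive) {k : Fin 3 → F} {y : Fin 6 → F}
    {B C : F × F → F} {b c : ℂ} (hB : ∀ t : Fˣ, ∑ x, ψ (t * B x) = b)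
    (hC : ∀ t : Fˣ, ∑ x, ψ (t * C x) = c) (σ : Fin 6 → Fin 6) (hσ : σ.Injective)
    (h : ∀ x, bformTQ (pencil k (pairing σ x).1 (pairing σ x).2) y =
      x.1.1 ^ 2 + B x.2.1 + C x.2.2) :
    pencilSum ψ k y = 0 := by
  rw [pencilSum_eq_sum_mul (A := fun x => x.1 ^ 2) σ hσ h]
  simp only [hB, hC, Fintype.sum_prod_type, Finset.sum_const, ← Finset.smul_sum, smul_mul_assoc]
  rw [← Finset.sum_mul, ← Finset.sum_mul, sum_units_sum_char_sq hψ]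
  simp

theorem pencilSum_sq (hψ : ψ.IsPrimitive) (h2 : ringChar F ≠ 2) {l : F} (hl : ¬ IsSquare l)
    (i : Fin 5) :
    pencilSum ψ ![1, 0, 0] (orbitRep l i) = Fintype.card Fˣ *
      ![(Fintype.card F : ℂ) ^ 6, 0, Fintype.card F ^ 5, -Fintype.card F ^ 5, 0] i := by
  have h20 : (2 : F) ≠ 0 := Ring.two_ne_zero h2
  have z := sum_char_zero ψ
  fin_cases i
  · rw [pencilSum_eq_mul z z z ![0, 2, 4, 1, 3, 5] (by decide)]
    · simp; ring
    · simp [orbitRep, bformTQ]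
  · rw [pencilSum_eq_zero hψ z z ![0, 2, 4, 1, 3, 5] (by decide)]
    · simp
    · simp [orbitRep, bformTQ, pairing, pencil, linProd, sq]
  · rw [pencilSum_eq_mul (sum_char_smul_mul_mul hψ one_ne_zero) z z ![0, 1, 4, 2, 3, 5] (by decide)]
    · simp; ring
    · simp [orbitRep, bformTQ, pairing, pencil, linProd]
      intros; field_simp; ring
  · rw [pencilSum_eq_mul (sum_char_smul_norm hψ h2 hl one_ne_zero) z z ![0, 1, 4, 2, 3, 5]
      (by decide)]
    · simp; ring
    · simp [orbitRep, bformTQ, pairing, pencil, linProd]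
      intros; ring
  · rw [pencilSum_eq_zero hψ (sum_char_smul_mul_mul hψ (neg_ne_zero.2 one_ne_zero)) z
      ![0, 2, 3, 1, 4, 5] (by decide)]
    · simp
    · simp [orbitRep, bformTQ, pairing, pencil, linProd]
      intros; field_simp; ring

theorem pencilSum_mul (hψ : ψ.IsPrimitive) (h2 : ringChar F ≠ 2) {l : F} (hl : ¬ IsSquare l)
    (i : Fin 5) :
    pencilSum ψ ![0, 1, 0] (orbitRep l i) = Fintype.card Fˣ *
      ![(Fintype.card F : ℂ) ^ 6, Fintype.card F ^ 5, Fintype.card F ^ 4, Fintype.card F ^ 4,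
        Fintype.card F ^ 3] i := by
  have hl0 : l ≠ 0 := fun h => hl (h ▸ IsSquare.zero)
  have h20 : (2 : F) ≠ 0 := Ring.two_ne_zero h2
  have z := sum_char_zero ψ
  have m := fun {m : F} => sum_char_smul_mul_mul (m := m) hψ
  fin_cases i
  · rw [pencilSum_eq_mul z z z ![0, 2, 4, 1, 3, 5] (by decide)]
    · simp; ring
    · simp [orbitRep, bformTQ]
  · rw [pencilSum_eq_mul (m one_ne_zero) z z ![0, 2, 4, 1, 3, 5] (by decide)]
    · simp; ring
    · simp [orbitRep, bformTQ, pairing, pencil, linProd]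
  · rw [pencilSum_eq_mul (m (inv_ne_zero h20)) (m (inv_ne_zero h20)) z ![0, 2, 4, 3, 1, 5]
      (by decide)]
    · simp; ring
    · simp [orbitRep, bformTQ, pairing, pencil, linProd]
      intros; ring
  · rw [pencilSum_eq_mul (m one_ne_zero) (m (neg_ne_zero.2 hl0)) z ![0, 2, 4, 1, 3, 5]
      (by decide)]
    · simp; ring
    · simp [orbitRep, bformTQ, pairing, pencil, linProd]
      intros; ring
  · rw [pencilSum_eq_mul (m one_ne_zero) (m (neg_ne_zero.2 (inv_ne_zero h20)))
      (m (neg_ne_zero.2 (inv_ne_zero h20))) ![0, 2, 4, 1, 5, 3] (by decide)]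
    · simp; ring
    · simp [orbitRep, bformTQ, pairing, pencil, linProd]
      intros; ring

theorem pencilSum_norm (hψ : ψ.IsPrimitive) (h2 : ringChar F ≠ 2) {l : F} (hl : ¬ IsSquare l)
    (i : Fin 5) :
    pencilSum ψ ![1, 0, -l] (orbitRep l i) = Fintype.card Fˣ *
      ![(Fintype.card F : ℂ) ^ 6, -Fintype.card F ^ 5, Fintype.card F ^ 4, Fintype.card F ^ 4,
        -Fintype.card F ^ 3] i := by
  have hl0 : l ≠ 0 := fun h => hl (h ▸ IsSquare.zero)
  have h20 : (2 : F) ≠ 0 := Ring.two_ne_zero h2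
  have z := sum_char_zero ψ
  have m := fun {m : F} => sum_char_smul_mul_mul (m := m) hψ
  have n := fun {m : F} => sum_char_smul_norm (m := m) hψ h2 hl
  fin_cases i
  · rw [pencilSum_eq_mul z z z ![0, 2, 4, 1, 3, 5] (by decide)]
    · simp; ring
    · simp [orbitRep, bformTQ]
  · rw [pencilSum_eq_mul (n one_ne_zero) z z ![0, 2, 4, 1, 3, 5] (by decide)]
    · simp; ring
    · simp [orbitRep, bformTQ, pairing, pencil, linProd]
      intros; ring
  · rw [pencilSum_eq_mul (m one_ne_zero) (m (neg_ne_zero.2 hl0)) z ![0, 1, 4, 2, 3, 5]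
      (by decide)]
    · simp; ring
    · simp [orbitRep, bformTQ, pairing, pencil, linProd]
      intros; field_simp; ring
  · rw [pencilSum_eq_mul (n one_ne_zero) (n (neg_ne_zero.2 hl0)) z ![0, 2, 4, 1, 3, 5]
      (by decide)]
    · simp; ring
    · simp [orbitRep, bformTQ, pairing, pencil, linProd]
      intros; ring
  · rw [pencilSum_eq_mul (n one_ne_zero) (m (neg_ne_zero.2 one_ne_zero)) (m hl0)
      ![0, 2, 3, 1, 4, 5] (by decide)]
    · simp; ring
    · simp [orbitRep, bformTQ, pairing, pencil, linProd]
      intros; field_simp; ring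

end PencilSum

/-! ### The orbit decomposition and the Fourier matrix -/

section OrbitSums

theorem vec_six_zero {K : Type*} [Zero K] : ![(0 : K), 0, 0, 0, 0, 0] = 0 := by
  simp

theorem pencilCount_sq_orbitRep (h2 : (2 : F) ≠ 0) {l : F} (hl : ¬ IsSquare l) (i : Fin 5) :
    pencilCount ![1, 0, 0] (orbitRep l i) =
      ![Fintype.card Fˣ * Fintype.card F ^ 3, Fintype.card Fˣ * Fintype.card F ^ 3, 0, 0, 0] i := by
  fin_cases i <;>
    simp [orbitRep, vec_six_zero, pencilCount_sq_zero, pencilCount_sq_sq, pencilCount_sq_mul,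
      pencilCount_sq_norm h2 hl, pencilCount_sq_conic]

theorem pencilCount_mul_orbitRep {l : F} (hl : ¬ IsSquare l) (i : Fin 5) :
    pencilCount ![0, 1, 0] (orbitRep l i) =
      ![Fintype.card Fˣ * (Fintype.card F ^ 3 + Fintype.card {a : Fin 3 → F // a ≠ 0}),
        Fintype.card Fˣ * Fintype.card Fˣ, 2 * (Fintype.card Fˣ * Fintype.card Fˣ), 0, 0] i := by
  fin_cases i <;>
    simp only [orbitRep, pencilCount_mul_sq, pencilCount_mul_mul, pencilCount_mul_norm hl,
      pencilCount_mul_conic, Fin.mk_one, Fin.zero_eta, Fin.reduceFinMk, Matrix.cons_val]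
  rw [vec_six_zero, pencilCount_mul_zero]

theorem pencilCount_norm_orbitRep (h2 : (2 : F) ≠ 0) {l : F} (hl : ¬ IsSquare l) (i : Fin 5) :
    pencilCount ![1, 0, -l] (orbitRep l i) =
      ![Fintype.card Fˣ, Fintype.card {x : F × F // x ≠ 0}, 0,
        2 * Fintype.card {x : F × F // x ≠ 0}, 0] i := by
  fin_cases i <;>
    simp only [orbitRep, pencilCount_norm_sq hl, pencilCount_norm_mul hl,
      pencilCount_norm_norm h2 hl, pencilCount_norm_conic hl,
      Fin.mk_one, Fin.zero_eta, Fin.reduceFinMk, Matrix.cons_val]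
  rw [vec_six_zero, pencilCount_norm_zero hl]

theorem eq_of_inOrbitTQ_orbitRep (h2 : (2 : F) ≠ 0) {l : F} (hl : ¬ IsSquare l) {x : Fin 6 → F}
    {i j : Fin 5} (hi : InOrbitTQ (orbitRep l i) x) (hj : InOrbitTQ (orbitRep l j) x) : i = j := by
  have h := inOrbitTQ_trans hi (inOrbitTQ_symm hj)
  have e1 := pencilCount_eq_of_inOrbitTQ (k := ![1, 0, 0]) h
  have e2 := pencilCount_eq_of_inOrbitTQ (k := ![0, 1, 0]) h
  have e3 := pencilCount_eq_of_inOrbitTQ (k := ![1, 0, -l]) h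
  rw [pencilCount_sq_orbitRep h2 hl, pencilCount_sq_orbitRep h2 hl] at e1
  rw [pencilCount_mul_orbitRep hl, pencilCount_mul_orbitRep hl] at e2
  rw [pencilCount_norm_orbitRep h2 hl, pencilCount_norm_orbitRep h2 hl] at e3
  have hu : Fintype.card Fˣ ≠ 0 := Fintype.card_ne_zero
  have hq : Fintype.card F ≠ 0 := Fintype.card_ne_zero
  have hn : Fintype.card {x : F × F // x ≠ 0} ≠ 0 :=
    have : Nonempty {x : F × F // x ≠ 0} := ⟨⟨(1, 0), by simp⟩⟩
    Fintype.card_ne_zero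
  have hlt : Fintype.card Fˣ < Fintype.card F ^ 3 + Fintype.card {a : Fin 3 → F // a ≠ 0} := by
    have := card_units_add_one F
    have := Nat.le_self_pow three_ne_zero (Fintype.card F)
    omega
  generalize Fintype.card {x : F × F // x ≠ 0} = n at *
  generalize Fintype.card F ^ 3 + Fintype.card {a : Fin 3 → F // a ≠ 0} = m at *
  generalize Fintype.card Fˣ = u at *
  generalize Fintype.card F = q at *
  fin_cases i <;> fin_cases j <;> simp [hu, hq, hn, hlt.ne, hlt.ne'] at e1 e2 e3 ⊢

/-- The sum of `ψ [x, y]` over the forms `x` in the `j`-th orbit. -/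
def orbitSum (ψ : AddChar F ℂ) (l : F) (j : Fin 5) (y : Fin 6 → F) : ℂ :=
  ∑ x, (if InOrbitTQ (orbitRep l j) x then 1 else 0) * ψ (bformTQ x y)

theorem sum_mul_indicator (h2 : ringChar F ≠ 2) {l : F} (hl : ¬ IsSquare l) (c : Fin 5 → ℂ)
    {x : Fin 6 → F} {i : Fin 5} (hi : InOrbitTQ (orbitRep l i) x) :
    ∑ j, c j * (if InOrbitTQ (orbitRep l j) x then 1 else 0) = c i := by
  rw [Finset.sum_eq_single i]
  · simp [hi]
  · intro j _ hj
    rw [if_neg fun h => hj (eq_of_inOrbitTQ_orbitRep (Ring.two_ne_zero h2) hl h hi), mul_zero]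
  · simp

theorem sum_eq_sum_orbitSum (h2 : ringChar F ≠ 2) {l : F} (hl : ¬ IsSquare l) (ψ : AddChar F ℂ)
    (y : Fin 6 → F) {f : (Fin 6 → F) → ℂ} {c : Fin 5 → ℂ}
    (hf : ∀ i x, InOrbitTQ (orbitRep l i) x → f x = c i) :
    ∑ x, f x * ψ (bformTQ x y) = ∑ j, c j * orbitSum ψ l j y := by
  simp only [orbitSum, Finset.mul_sum]
  rw [Finset.sum_comm]
  refine Finset.sum_congr rfl fun x _ => ?_
  obtain ⟨i, hi⟩ := exists_inOrbitTQ_orbitRep h2 hl x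
  simp only [← mul_assoc]
  rw [← Finset.sum_mul, sum_mul_indicator h2 hl c hi, hf i x hi]

theorem pencilSum_eq_sum_orbitSum (h2 : ringChar F ≠ 2) {l : F} (hl : ¬ IsSquare l)
    (ψ : AddChar F ℂ) (k : Fin 3 → F) (y : Fin 6 → F) :
    pencilSum ψ k y = ∑ j, (pencilCount k (orbitRep l j) : ℂ) * orbitSum ψ l j y := by
  rw [pencilSum_eq_sum_pencilCount]
  exact sum_eq_sum_orbitSum h2 hl ψ y fun i x h => by rw [pencilCount_eq_of_inOrbitTQ h]

theorem inOrbitTQ_zero_iff {K : Type*} [Field K] {x : Fin 6 → K} : InOrbitTQ 0 x ↔ x = 0 := by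
  have h (t : K) (g : Matrix (Fin 3) (Fin 3) K) : formAct t g 0 = 0 := by
    simpa using formAct_smul t 0 g 0
  rw [inOrbitTQ_iff]
  constructor
  · rintro ⟨t, g, -, -, rfl⟩
    exact h t g
  · rintro rfl
    exact ⟨1, 1, one_ne_zero, by simp, h 1 1⟩

theorem orbitRep_zero {K : Type*} [Field K] (l : K) : orbitRep l 0 = 0 := by
  simp [orbitRep]

theorem orbitSum_zero (ψ : AddChar F ℂ) (l : F) (y : Fin 6 → F) : orbitSum ψ l 0 y = 1 := by
  simp [orbitSum, orbitRep_zero, inOrbitTQ_zero_iff, bformTQ]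

theorem exists_bformTQ_eq {K : Type*} [Field K] (h2 : (2 : K) ≠ 0) {y : Fin 6 → K} (hy : y ≠ 0)
    (c : K) : ∃ x, bformTQ x y = c := by
  obtain ⟨i, hi⟩ := Function.ne_iff.1 hy
  have : ∃ x, bformTQ x y ≠ 0 := by
    refine ⟨Pi.single i 1, ?_⟩
    fin_cases i <;> simpa [bformTQ, h2] using hi
  obtain ⟨x, hx⟩ := this
  exact ⟨(c / bformTQ x y) • x, by rw [bformTQ_smul_left, div_mul_cancel₀ _ hx]⟩

theorem sum_char_bformTQ {ψ : AddChar F ℂ} (hψ : ψ.IsPrimitive) (h2 : (2 : F) ≠ 0)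
    (y : Fin 6 → F) :
    ∑ x, ψ (bformTQ x y) = if y = 0 then (Fintype.card F : ℂ) ^ 6 else 0 := by
  split_ifs with hy
  · simp [hy, bformTQ]
  · obtain ⟨c, hc⟩ := AddChar.ne_one_iff.1 (by simpa using hψ one_ne_zero)
    obtain ⟨z, rfl⟩ := exists_bformTQ_eq h2 hy c
    refine eq_zero_of_mul_eq_self_left hc ?_
    rw [Finset.mul_sum, ← Equiv.sum_comp (Equiv.addLeft z) fun x => ψ (bformTQ x y)]
    exact Finset.sum_congr rfl fun x _ => by
      rw [Equiv.coe_addLeft, bformTQ_add_left, AddChar.map_add_eq_mul]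

theorem sum_orbitSum {ψ : AddChar F ℂ} (hψ : ψ.IsPrimitive) (h2 : ringChar F ≠ 2) {l : F}
    (hl : ¬ IsSquare l) {i : Fin 5} {y : Fin 6 → F} (hy : InOrbitTQ (orbitRep l i) y) :
    ∑ j, orbitSum ψ l j y = if i = 0 then (Fintype.card F : ℂ) ^ 6 else 0 := by
  have h := sum_eq_sum_orbitSum h2 hl ψ y (f := fun _ => 1) (c := fun _ => 1) fun _ _ _ => rfl
  have h0 : y = 0 ↔ i = 0 := by
    rw [← inOrbitTQ_zero_iff, ← orbitRep_zero l]
    exact ⟨eq_of_inOrbitTQ_orbitRep (Ring.two_ne_zero h2) hl hy, fun h => h ▸ hy⟩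
  simp only [one_mul] at h
  simp only [← h, sum_char_bformTQ hψ (Ring.two_ne_zero h2), h0]

end OrbitSums

section FourierMatrix

theorem orbitSum_eq {ψ : AddChar F ℂ} (hψ : ψ.IsPrimitive) (h2 : ringChar F ≠ 2) {l : F}
    (hl : ¬ IsSquare l) {i : Fin 5} {y : Fin 6 → F} (hy : InOrbitTQ (orbitRep l i) y) {q : ℂ}
    (hqF : q = Fintype.card F) (j : Fin 5) :
    orbitSum ψ l j y =
      !![1, q^3-1, q*(q+1)*(q^3-1)/2, q*(q-1)*(q^3-1)/2, q^2*(q-1)*(q^3-1);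
         1, -1, q*(q+1)*(q^2-1)/2, -(q*(q-1)*(q^2+1)/2), -(q^2*(q-1));
         1, q^2-1, q*(q^2-2*q-1)/2, q*(q-1)^2/2, -(q^2*(q-1));
         1, -q^2-1, q*(q^2-1)/2, q*(q^2+1)/2, -(q^2*(q-1));
         1, -1, -(q*(q+1)/2), -(q*(q-1)/2), q^2] i j := by
  have h20 : (2 : F) ≠ 0 := Ring.two_ne_zero h2
  have hq : q ≠ 0 := by simp [hqF]
  have hq1 : q + 1 ≠ 0 := by
    rw [hqF]
    exact_mod_cast (Fintype.card F).succ_ne_zero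
  have hu : (Fintype.card Fˣ : ℂ) = q - 1 := by
    rw [hqF, ← card_units_add_one F]
    push_cast
    ring
  have hu0 : q - 1 ≠ 0 := by simp [← hu]
  have hn : (Fintype.card {x : F × F // x ≠ 0} : ℂ) = q ^ 2 - 1 := by
    have := card_ne_zero_add_one (F × F)
    rw [Fintype.card_prod, ← sq] at this
    rw [hqF, eq_sub_iff_add_eq]
    exact_mod_cast this
  have hm : (Fintype.card {a : Fin 3 → F // a ≠ 0} : ℂ) = q ^ 3 - 1 := by
    have := card_ne_zero_add_one (Fin 3 → F)
    rw [Fintype.card_fun, Fintype.card_fin] at this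
    rw [hqF, eq_sub_iff_add_eq]
    exact_mod_cast this
  have e0 := orbitSum_zero ψ l y
  have hS := sum_orbitSum hψ h2 hl hy
  have hA := pencilSum_eq_sum_orbitSum h2 hl ψ ![1, 0, 0] y
  have hB := pencilSum_eq_sum_orbitSum h2 hl ψ ![0, 1, 0] y
  have hC := pencilSum_eq_sum_orbitSum h2 hl ψ ![1, 0, -l] y
  rw [pencilSum_eq_of_inOrbitTQ h20 ψ hy, pencilSum_sq hψ h2 hl] at hA
  rw [pencilSum_eq_of_inOrbitTQ h20 ψ hy, pencilSum_mul hψ h2 hl] at hB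
  rw [pencilSum_eq_of_inOrbitTQ h20 ψ hy, pencilSum_norm hψ h2 hl] at hC
  simp only [pencilCount_sq_orbitRep h20 hl, pencilCount_mul_orbitRep hl,
    pencilCount_norm_orbitRep h20 hl, Fin.sum_univ_five, Matrix.cons_val, Nat.cast_mul,
    Nat.cast_pow, Nat.cast_add, Nat.cast_ofNat, Nat.cast_zero, hu, hn, hm, ← hqF, e0] at hS hA hB hC
  have e1 : orbitSum ψ l 1 y = ![q ^ 6, 0, q ^ 5, -q ^ 5, 0] i / q ^ 3 - 1 := by
    rw [eq_sub_iff_add_eq, eq_div_iff (pow_ne_zero 3 hq)]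
    refine mul_left_cancel₀ hu0 ?_
    linear_combination -hA
  have e2 : orbitSum ψ l 2 y = (![q ^ 6, q ^ 5, q ^ 4, q ^ 4, q ^ 3] i - (2 * q ^ 3 - 1) -
      (q - 1) * orbitSum ψ l 1 y) / (2 * (q - 1)) := by
    rw [eq_div_iff (mul_ne_zero two_ne_zero hu0)]
    refine mul_left_cancel₀ hu0 ?_
    linear_combination -hB
  have e3 : orbitSum ψ l 3 y = (![q ^ 6, -q ^ 5, q ^ 4, q ^ 4, -q ^ 3] i - 1 -
      (q + 1) * orbitSum ψ l 1 y) / (2 * (q + 1)) := by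
    rw [eq_div_iff (mul_ne_zero two_ne_zero hq1)]
    refine mul_left_cancel₀ hu0 ?_
    linear_combination -hC
  have e4 := eq_sub_of_add_eq' hS
  rw [e1] at e2 e3
  rw [e1, e2, e3] at e4
  fin_cases j <;> simp only [Fin.mk_one, Fin.zero_eta, Fin.reduceFinMk, e0, e1, e2, e3, e4] <;>
    fin_cases i <;> simp <;> field_simp <;> ring

end FourierMatrix

/-- the Fourier transform matrix for ternary quadratic forms, `p ≠ 2`. -/
theorem stmt14 (p : ℕ) [Fact p.Prime] [CharP F p] (hp : p ≠ 2) (l : F) (hl : ¬ IsSquare l) :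
    let r : Fin 5 → Fin 6 → F :=
      ![![0,0,0,0,0,0], ![1,0,0,0,0,0], ![0,1,0,0,0,0], ![1,0,0,-l,0,0], ![1,0,0,0,-1,0]]
    let q : ℚ := (Fintype.card F : ℚ)
    let M : Matrix (Fin 5) (Fin 5) ℚ :=
      !![1, q^3-1, q*(q+1)*(q^3-1)/2, q*(q-1)*(q^3-1)/2, q^2*(q-1)*(q^3-1);
         1, -1, q*(q+1)*(q^2-1)/2, -(q*(q-1)*(q^2+1)/2), -(q^2*(q-1));
         1, q^2-1, q*(q^2-2*q-1)/2, q*(q-1)^2/2, -(q^2*(q-1));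
         1, -q^2-1, q*(q^2-1)/2, q*(q^2+1)/2, -(q^2*(q-1));
         1, -1, -(q*(q+1)/2), -(q*(q-1)/2), q^2]
    ∀ (i j : Fin 5) (y : Fin 6 → F), InOrbitTQ (r i) y →
      (Fintype.card F : ℂ) ^ 6 * FTTQ p (fun x => if InOrbitTQ (r j) x then 1 else 0) y
        = (M i j : ℂ) := by
  intro r q M i j y hy
  have h2 : ringChar F ≠ 2 := by rwa [ringChar.eq F p]
  obtain ⟨ψ, hψ, hψF⟩ := exists_isPrimitive_eq_psiF (F := F) p
  have hq : (Fintype.card F : ℂ) ^ 6 ≠ 0 := by simp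
  rw [FTTQ, mul_inv_cancel_left₀ hq]
  simp only [hψF]
  refine (orbitSum_eq hψ h2 hl hy (q := q) (by simp [q]) j).trans ?_
  fin_cases i <;> fin_cases j <;> simp [M]

end
end

section
/- Assume p ≠ 2 and let l ∈ F_q^× be a non-square. The action of G = GL_2(F_q) × GL_2(F_q) on the space V of pairs of binary quadratic forms has exactly seven orbits, with representatives (0,0), (0,v^2), (0,uv), (0,u^2 − l v^2), (v^2, uv), (v^2, u^2), and (uv, u^2 + l v^2); the rank of the 2×3 coefficient matrix of any element of these orbits is respectively 0, 1, 1, 1, 2, 2, 2; and the orbit sizes are respectively 1, (q−1)(q+1)^2, q(q−1)(q+1)^2/2, q(q−1)^2(q+1)/2, q(q^2−1)^2, (q^3−q)^2/2, and (q^2−q)^2(q^2−1)/2. -/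
open scoped Classical
open MvPolynomial Matrix

noncomputable section

variable {F : Type*} [Field F] [Fintype F]

/-- The binary quadratic form `a u² + b uv + c v²` attached to `(a,b,c)`. -/
def toPolyBQ (x : Fin 3 → F) : MvPolynomial (Fin 2) F :=
  C (x 0) * X 0 ^ 2 + C (x 1) * X 0 * X 1 + C (x 2) * X 1 ^ 2

/-- Substitution corresponding to the linear change of variables `(u,v) ↦ (u,v)·g`. -/
def subst2 (g : Matrix (Fin 2) (Fin 2) F) (P : MvPolynomial (Fin 2) F) : MvPolynomial (Fin 2) F :=
  aeval (fun j => ∑ i : Fin 2, C (g i j) * X i) P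

/-- The action of `GL₂(F) × GL₂(F)` on pairs of binary quadratic forms:
`(g₁,g₂)∘(A,B) = (α g₂Ag₂ᵀ + β g₂Bg₂ᵀ, γ g₂Ag₂ᵀ + δ g₂Bg₂ᵀ)` for `g₁ = [[α,β],[γ,δ]]`,
written at the level of the associated quadratic forms. -/
def pairActB (g₁ g₂ : Matrix.GeneralLinearGroup (Fin 2) F)
    (PQ : MvPolynomial (Fin 2) F × MvPolynomial (Fin 2) F) :
    MvPolynomial (Fin 2) F × MvPolynomial (Fin 2) F :=
  (C ((g₁ : Matrix (Fin 2) (Fin 2) F) 0 0) * subst2 (g₂ : Matrix (Fin 2) (Fin 2) F) PQ.1 +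
     C ((g₁ : Matrix (Fin 2) (Fin 2) F) 0 1) * subst2 (g₂ : Matrix (Fin 2) (Fin 2) F) PQ.2,
   C ((g₁ : Matrix (Fin 2) (Fin 2) F) 1 0) * subst2 (g₂ : Matrix (Fin 2) (Fin 2) F) PQ.1 +
     C ((g₁ : Matrix (Fin 2) (Fin 2) F) 1 1) * subst2 (g₂ : Matrix (Fin 2) (Fin 2) F) PQ.2)

/-- `x` lies in the `GL₂(F) × GL₂(F)`-orbit of `r` (pairs of binary quadratic forms). -/
def InOrbitPB (r x : (Fin 3 → F) × (Fin 3 → F)) : Prop :=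
  ∃ g₁ g₂ : Matrix.GeneralLinearGroup (Fin 2) F,
    pairActB g₁ g₂ (toPolyBQ r.1, toPolyBQ r.2) = (toPolyBQ x.1, toPolyBQ x.2)

/-- The 2×3 coefficient matrix of a pair of binary quadratic forms. -/
def coeffMatPB (x : (Fin 3 → F) × (Fin 3 → F)) : Matrix (Fin 2) (Fin 3) F :=
  !![x.1 0, x.1 1, x.1 2; x.2 0, x.2 1, x.2 2]


/-! ### Binary quadratic forms in coordinates -/

variable {K : Type*} [Field K]

/-- The discriminant of a binary quadratic form. -/
def bqDisc (Q : Fin 3 → F) : F := Q 1 ^ 2 - 4 * Q 0 * Q 2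

/-- The coefficients of the form obtained from `Q` by the substitution `(u,v) ↦ (u,v)·g`. -/
def bqSubst (g : Matrix (Fin 2) (Fin 2) F) (Q : Fin 3 → F) : Fin 3 → F :=
  ![Q 0 * g 0 0 ^ 2 + Q 1 * g 0 0 * g 0 1 + Q 2 * g 0 1 ^ 2,
    2 * Q 0 * g 0 0 * g 1 0 + Q 1 * (g 0 0 * g 1 1 + g 1 0 * g 0 1) + 2 * Q 2 * g 0 1 * g 1 1,
    Q 0 * g 1 0 ^ 2 + Q 1 * g 1 0 * g 1 1 + Q 2 * g 1 1 ^ 2]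

/-- Half the Jacobian determinant of a pair of binary quadratic forms. -/
def bqJac (x : (Fin 3 → F) × (Fin 3 → F)) : Fin 3 → F :=
  ![x.1 0 * x.2 1 - x.1 1 * x.2 0, 2 * (x.1 0 * x.2 2 - x.1 2 * x.2 0),
    x.1 1 * x.2 2 - x.1 2 * x.2 1]

/-- The action of a `2 × 2` matrix on pairs of forms by linear combinations. -/
def pairComb (M : Matrix (Fin 2) (Fin 2) F) (x : (Fin 3 → F) × (Fin 3 → F)) :
    (Fin 3 → F) × (Fin 3 → F) :=
  (M 0 0 • x.1 + M 0 1 • x.2, M 1 0 • x.1 + M 1 1 • x.2)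

/-- A nonzero member of the pencil spanned by a pair, when there is one. -/
def pairRep (x : (Fin 3 → F) × (Fin 3 → F)) : Fin 3 → F := if x.1 = 0 then x.2 else x.1

/-- Equivalence of binary quadratic forms up to substitution and scaling. -/
def FormSim (Q₀ Q : Fin 3 → F) : Prop :=
  ∃ k : F, k ≠ 0 ∧ ∃ g : GL (Fin 2) F, Q = k • bqSubst (g : Matrix (Fin 2) (Fin 2) F) Q₀

theorem funext_three {α : Type*} {P Q : Fin 3 → α} (h0 : P 0 = Q 0) (h1 : P 1 = Q 1) (h2 : P 2 = Q 2) :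
    P = Q := by
  funext i
  fin_cases i <;> assumption

theorem ne_zero_three {Q : Fin 3 → K} (h : Q ≠ 0) : Q 0 ≠ 0 ∨ Q 1 ≠ 0 ∨ Q 2 ≠ 0 := by
  by_contra! hQ
  exact h (funext_three hQ.1 hQ.2.1 hQ.2.2)

theorem gl_det_ne_zero (g : GL (Fin 2) K) : (g : Matrix (Fin 2) (Fin 2) K).det ≠ 0 :=
  g.isUnit.map Matrix.detMonoidHom |>.ne_zero

theorem exists_gl {M : Matrix (Fin 2) (Fin 2) K} (h : M.det ≠ 0) :
    ∃ g : GL (Fin 2) K, (g : Matrix (Fin 2) (Fin 2) K) = M :=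
  ⟨Matrix.GeneralLinearGroup.mkOfDetNeZero M h, rfl⟩

theorem toPolyBQ_injective : Function.Injective (toPolyBQ (F := K)) := by
  intro P Q h
  have h0 := congrArg (coeff (Finsupp.single 0 2)) h
  have h1 := congrArg (coeff (Finsupp.single 0 1 + Finsupp.single 1 1)) h
  have h2 := congrArg (coeff (Finsupp.single 1 2)) h
  have key (Q : Fin 3 → K) : toPolyBQ Q = monomial (Finsupp.single 0 2) (Q 0) +
      monomial (Finsupp.single 0 1 + Finsupp.single 1 1) (Q 1) +
      monomial (Finsupp.single 1 2) (Q 2) := by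
    rw [toPolyBQ, X_pow_eq_monomial, X_pow_eq_monomial, mul_assoc, X, X, monomial_mul,
      C_mul_monomial, C_mul_monomial, C_mul_monomial, mul_one, mul_one, mul_one, mul_one]
  have d1 : (Finsupp.single 0 2 : Fin 2 →₀ ℕ) ≠ Finsupp.single 0 1 + Finsupp.single 1 1 :=
    fun h => by simpa using DFunLike.congr_fun h 1
  have d2 : (Finsupp.single 0 2 : Fin 2 →₀ ℕ) ≠ Finsupp.single 1 2 :=
    fun h => by simpa using DFunLike.congr_fun h 1
  have d3 : (Finsupp.single 0 1 + Finsupp.single 1 1 : Fin 2 →₀ ℕ) ≠ Finsupp.single 1 2 :=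
    fun h => by simpa using DFunLike.congr_fun h 0
  simp only [key, coeff_add, coeff_monomial, d1, d2, d3, d1.symm, d2.symm, d3.symm, if_true,
    if_false, add_zero, zero_add] at h0 h1 h2
  exact funext_three h0 h1 h2

theorem subst2_toPolyBQ (g : Matrix (Fin 2) (Fin 2) K) (Q : Fin 3 → K) :
    subst2 g (toPolyBQ Q) = toPolyBQ (bqSubst g Q) := by
  simp only [subst2, toPolyBQ, bqSubst, map_add, map_mul, map_pow, aeval_X, algHom_C,
    algebraMap_eq, Fin.sum_univ_two, Matrix.cons_val, map_ofNat]
  ring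

theorem inOrbitPB_iff (r x : (Fin 3 → K) × (Fin 3 → K)) :
    InOrbitPB r x ↔ ∃ g₁ g₂ : GL (Fin 2) K,
      x = pairComb (g₁ : Matrix (Fin 2) (Fin 2) K)
        (bqSubst (g₂ : Matrix (Fin 2) (Fin 2) K) r.1, bqSubst (g₂ : Matrix (Fin 2) (Fin 2) K) r.2)
      := by
  have lin (s t : K) (P Q : Fin 3 → K) :
      C s * toPolyBQ P + C t * toPolyBQ Q = toPolyBQ (s • P + t • Q) := by
    simp only [toPolyBQ, Pi.add_apply, Pi.smul_apply, smul_eq_mul, map_add, map_mul]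
    ring
  simp only [InOrbitPB, pairActB, subst2_toPolyBQ, lin,
    toPolyBQ_injective.eq_iff, pairComb, Prod.ext_iff, eq_comm]

theorem bqSubst_mul (g h : Matrix (Fin 2) (Fin 2) K) (Q : Fin 3 → K) :
    bqSubst (g * h) Q = bqSubst g (bqSubst h Q) := by
  apply funext_three <;>
    simp only [bqSubst, Matrix.mul_apply, Fin.sum_univ_two, Matrix.cons_val] <;> ring

theorem bqSubst_one (Q : Fin 3 → K) : bqSubst 1 Q = Q := by
  apply funext_three <;> simp [bqSubst]

theorem bqSubst_zero (g : Matrix (Fin 2) (Fin 2) K) : bqSubst g 0 = 0 := by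
  apply funext_three <;> simp [bqSubst]

theorem bqSubst_smul (g : Matrix (Fin 2) (Fin 2) K) (k : K) (Q : Fin 3 → K) :
    bqSubst g (k • Q) = k • bqSubst g Q := by
  apply funext_three <;>
    simp only [bqSubst, Pi.smul_apply, smul_eq_mul, Matrix.cons_val] <;> ring

theorem bqSubst_ne_zero (g : GL (Fin 2) K) {Q : Fin 3 → K} (hQ : Q ≠ 0) :
    bqSubst (g : Matrix (Fin 2) (Fin 2) K) Q ≠ 0 := by
  intro h
  apply hQ
  have := bqSubst_mul ((g⁻¹ : GL (Fin 2) K) : Matrix (Fin 2) (Fin 2) K) g Q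
  rwa [h, bqSubst_zero, ← Units.val_mul, inv_mul_cancel, Units.val_one, bqSubst_one] at this

theorem bqDisc_bqSubst (g : Matrix (Fin 2) (Fin 2) K) (Q : Fin 3 → K) :
    bqDisc (bqSubst g Q) = g.det ^ 2 * bqDisc Q := by
  simp only [bqDisc, bqSubst, Matrix.det_fin_two, Matrix.cons_val]
  ring

theorem bqDisc_smul (k : K) (Q : Fin 3 → K) : bqDisc (k • Q) = k ^ 2 * bqDisc Q := by
  simp only [bqDisc, Pi.smul_apply, smul_eq_mul]
  ring

theorem bqJac_bqSubst (g : Matrix (Fin 2) (Fin 2) K) (x : (Fin 3 → K) × (Fin 3 → K)) :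
    bqJac (bqSubst g x.1, bqSubst g x.2) = g.det • bqSubst g (bqJac x) := by
  apply funext_three <;>
    simp only [bqJac, bqSubst, Matrix.det_fin_two, Matrix.cons_val, Pi.smul_apply, smul_eq_mul] <;>
    ring

theorem bqJac_pairComb (M : Matrix (Fin 2) (Fin 2) K) (x : (Fin 3 → K) × (Fin 3 → K)) :
    bqJac (pairComb M x) = M.det • bqJac x := by
  apply funext_three <;>
    simp only [bqJac, pairComb, Matrix.det_fin_two, Matrix.cons_val, Pi.smul_apply, Pi.add_apply,
      smul_eq_mul] <;>
    ring

/-! ### Classification of single forms -/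

theorem formSim_smul_left {c : K} (hc : c ≠ 0) (Q₀ Q : Fin 3 → K) :
    FormSim (c • Q₀) Q ↔ FormSim Q₀ Q := by
  constructor
  · rintro ⟨k, hk, g, rfl⟩
    exact ⟨k * c, mul_ne_zero hk hc, g, by rw [bqSubst_smul, smul_smul]⟩
  · rintro ⟨k, hk, g, rfl⟩
    exact ⟨k / c, div_ne_zero hk hc, g, by rw [bqSubst_smul, smul_smul, div_mul_cancel₀ _ hc]⟩

theorem FormSim.ne_zero {Q₀ Q : Fin 3 → K} (h : FormSim Q₀ Q) (h₀ : Q₀ ≠ 0) : Q ≠ 0 := by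
  obtain ⟨k, hk, g, rfl⟩ := h
  exact smul_ne_zero hk (bqSubst_ne_zero g h₀)

theorem FormSim.exists_disc {Q₀ Q : Fin 3 → K} (h : FormSim Q₀ Q) :
    ∃ c : K, c ≠ 0 ∧ bqDisc Q = c ^ 2 * bqDisc Q₀ := by
  obtain ⟨k, hk, g, rfl⟩ := h
  refine ⟨k * (g : Matrix (Fin 2) (Fin 2) K).det, mul_ne_zero hk (gl_det_ne_zero g), ?_⟩
  rw [bqDisc_smul, bqDisc_bqSubst]
  ring

theorem formSim_of_coeff {Q₀ Q : Fin 3 → K} (k a b c d : K) (hk : k ≠ 0)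
    (hdet : a * d - b * c ≠ 0) (h : Q = k • bqSubst !![a, b; c, d] Q₀) : FormSim Q₀ Q := by
  obtain ⟨g, hg⟩ := exists_gl (M := !![a, b; c, d]) (by rwa [Matrix.det_fin_two_of])
  exact ⟨k, hk, g, by rw [hg, h]⟩

theorem formSim_square_iff (h2 : (2 : K) ≠ 0) (Q : Fin 3 → K) :
    FormSim ![0, 0, 1] Q ↔ Q ≠ 0 ∧ bqDisc Q = 0 := by
  constructor
  · intro h
    refine ⟨h.ne_zero fun h => by simpa using congrFun h 2, ?_⟩
    obtain ⟨c, -, hc⟩ := h.exists_disc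
    simpa [bqDisc] using hc
  · rintro ⟨hQ, hd⟩
    unfold bqDisc at hd
    by_cases ha : Q 0 = 0
    · have hb : Q 1 = 0 := by simpa [ha] using hd
      have hc : Q 2 ≠ 0 := by simpa [ha, hb] using ne_zero_three hQ
      refine formSim_of_coeff (Q 2) 1 0 0 1 hc (by simp) (funext_three ?_ ?_ ?_) <;>
        simp [bqSubst, ha, hb]
    · refine formSim_of_coeff (Q 0) 0 1 1 (Q 1 / (2 * Q 0)) ha (by simp)
        (funext_three ?_ ?_ ?_) <;> simp [bqSubst] <;> field_simp
      linear_combination -hd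

theorem formSim_split_iff (h2 : (2 : K) ≠ 0) (Q : Fin 3 → K) :
    FormSim ![0, 1, 0] Q ↔ Q ≠ 0 ∧ bqDisc Q ≠ 0 ∧ IsSquare (bqDisc Q) := by
  constructor
  · intro h
    refine ⟨h.ne_zero fun h => by simpa using congrFun h 1, ?_⟩
    obtain ⟨c, hc0, hc⟩ := h.exists_disc
    have : bqDisc (![0, 1, 0] : Fin 3 → K) = 1 := by simp [bqDisc]
    rw [hc, this, mul_one]
    exact ⟨pow_ne_zero 2 hc0, IsSquare.sq c⟩
  · rintro ⟨hQ, hd, s, hs⟩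
    have hs0 : s ≠ 0 := by
      rintro rfl
      exact hd (by simpa using hs)
    unfold bqDisc at hs
    by_cases ha : Q 0 = 0
    · have hb : Q 1 ≠ 0 := by simpa [bqDisc, ha] using hd
      refine formSim_of_coeff 1 0 (Q 1) 1 (Q 2) one_ne_zero (by simpa using hb)
        (funext_three ?_ ?_ ?_) <;> simp [bqSubst, ha]
    · refine formSim_of_coeff (Q 0) 1 1 ((Q 1 - s) / (2 * Q 0)) ((Q 1 + s) / (2 * Q 0)) ha ?_
        (funext_three ?_ ?_ ?_)
      · have : 1 * ((Q 1 + s) / (2 * Q 0)) - 1 * ((Q 1 - s) / (2 * Q 0)) = s / Q 0 := by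
          field_simp
          ring
        rw [this]
        exact div_ne_zero hs0 ha
      · simp [bqSubst]
      · simp [bqSubst]
        field_simp
        ring
      · simp [bqSubst]
        field_simp
        linear_combination -hs

theorem isSquare_mul_of_not_isSquare {a b : F} (ha : ¬ IsSquare a) (hb : ¬ IsSquare b) :
    IsSquare (a * b) := by
  have ha0 : a ≠ 0 := by
    rintro rfl
    exact ha (IsSquare.zero)
  have hb0 : b ≠ 0 := by
    rintro rfl
    exact hb (IsSquare.zero)
  rw [← quadraticChar_one_iff_isSquare (mul_ne_zero ha0 hb0), map_mul,
    quadraticChar_neg_one_iff_not_isSquare.2 ha, quadraticChar_neg_one_iff_not_isSquare.2 hb]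
  norm_num

theorem isSquare_sq_mul_iff {c : K} (hc : c ≠ 0) (d : K) : IsSquare (c ^ 2 * d) ↔ IsSquare d := by
  constructor
  · intro h
    have := h.mul (IsSquare.sq c⁻¹)
    rwa [mul_right_comm, ← mul_pow, mul_inv_cancel₀ hc, one_pow, one_mul] at this
  · exact (IsSquare.sq c).mul

theorem formSim_nonsplit_iff (h2 : (2 : F) ≠ 0) {l : F} (hl : ¬ IsSquare l) (Q : Fin 3 → F) :
    FormSim ![1, 0, -l] Q ↔ Q ≠ 0 ∧ ¬ IsSquare (bqDisc Q) := by
  constructor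
  · intro h
    refine ⟨h.ne_zero fun h => by simpa using congrFun h 0, ?_⟩
    obtain ⟨c, hc0, hc⟩ := h.exists_disc
    have : bqDisc (![1, 0, -l] : Fin 3 → F) = 2 ^ 2 * l := by
      simp only [bqDisc, Matrix.cons_val]
      ring
    rwa [hc, this, isSquare_sq_mul_iff hc0, isSquare_sq_mul_iff h2]
  · rintro ⟨hQ, hd⟩
    have hl0 : l ≠ 0 := by
      rintro rfl
      exact hl IsSquare.zero
    have ha : Q 0 ≠ 0 := by
      intro ha
      apply hd
      simpa [bqDisc, ha] using IsSquare.sq (Q 1)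
    obtain ⟨w, hw⟩ := isSquare_mul_of_not_isSquare hd hl
    have hw0 : w ≠ 0 := by
      rintro rfl
      rw [mul_zero, mul_eq_zero, or_iff_left hl0] at hw
      exact hd (hw ▸ IsSquare.zero)
    unfold bqDisc at hw
    refine formSim_of_coeff (Q 0) 1 0 (Q 1 / (2 * Q 0)) (w / (2 * l * Q 0)) ha ?_
      (funext_three ?_ ?_ ?_)
    · rw [one_mul, zero_mul, sub_zero]
      positivity
    · simp [bqSubst]
    · simp [bqSubst]
      field_simp
    · simp [bqSubst]
      field_simp
      linear_combination -hw

/-! ### Classification of pairs -/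

theorem pairComb_injective {x : (Fin 3 → K) × (Fin 3 → K)} (hx : bqJac x ≠ 0) {s t : K}
    (h : s • x.1 + t • x.2 = 0) : s = 0 ∧ t = 0 := by
  have e (i : Fin 3) : s * x.1 i + t * x.2 i = 0 := congrFun h i
  have hs : s • bqJac x = 0 := by
    apply funext_three <;>
      simp only [bqJac, Pi.smul_apply, Pi.zero_apply, smul_eq_mul, Matrix.cons_val]
    · linear_combination x.2 1 * e 0 - x.2 0 * e 1
    · linear_combination 2 * (x.2 2 * e 0 - x.2 0 * e 2)
    · linear_combination x.2 2 * e 1 - x.2 1 * e 2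
  have ht : t • bqJac x = 0 := by
    apply funext_three <;>
      simp only [bqJac, Pi.smul_apply, Pi.zero_apply, smul_eq_mul, Matrix.cons_val]
    · linear_combination x.1 0 * e 1 - x.1 1 * e 0
    · linear_combination 2 * (x.1 0 * e 2 - x.1 2 * e 0)
    · linear_combination x.1 1 * e 2 - x.1 2 * e 1
  exact ⟨(smul_eq_zero.1 hs).resolve_right hx, (smul_eq_zero.1 ht).resolve_right hx⟩

theorem exists_eq_comb (h2 : (2 : K) ≠ 0) {y : (Fin 3 → K) × (Fin 3 → K)} (hy : bqJac y ≠ 0)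
    {A : Fin 3 → K} (h : 2 * A 0 * bqJac y 2 - A 1 * bqJac y 1 + 2 * A 2 * bqJac y 0 = 0) :
    ∃ s t : K, A = s • y.1 + t • y.2 := by
  have hm := ne_zero_three hy
  simp only [bqJac, Matrix.cons_val] at h hm
  rcases hm with hm | hm | hm
  · refine ⟨(A 0 * y.2 1 - A 1 * y.2 0) / (y.1 0 * y.2 1 - y.1 1 * y.2 0),
      (y.1 0 * A 1 - y.1 1 * A 0) / (y.1 0 * y.2 1 - y.1 1 * y.2 0), funext_three ?_ ?_ ?_⟩ <;>
      simp only [Pi.add_apply, Pi.smul_apply, smul_eq_mul] <;>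
      rw [div_mul_eq_mul_div, div_mul_eq_mul_div, ← add_div, eq_div_iff hm]
    · ring
    · ring
    · apply mul_left_cancel₀ h2
      linear_combination h
  · have hm := right_ne_zero_of_mul hm
    refine ⟨(A 0 * y.2 2 - A 2 * y.2 0) / (y.1 0 * y.2 2 - y.1 2 * y.2 0),
      (y.1 0 * A 2 - y.1 2 * A 0) / (y.1 0 * y.2 2 - y.1 2 * y.2 0), funext_three ?_ ?_ ?_⟩ <;>
      simp only [Pi.add_apply, Pi.smul_apply, smul_eq_mul] <;>
      rw [div_mul_eq_mul_div, div_mul_eq_mul_div, ← add_div, eq_div_iff hm]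
    · ring
    · apply mul_left_cancel₀ h2
      linear_combination -h
    · ring
  · refine ⟨(A 1 * y.2 2 - A 2 * y.2 1) / (y.1 1 * y.2 2 - y.1 2 * y.2 1),
      (y.1 1 * A 2 - y.1 2 * A 1) / (y.1 1 * y.2 2 - y.1 2 * y.2 1), funext_three ?_ ?_ ?_⟩ <;>
      simp only [Pi.add_apply, Pi.smul_apply, smul_eq_mul] <;>
      rw [div_mul_eq_mul_div, div_mul_eq_mul_div, ← add_div, eq_div_iff hm]
    · apply mul_left_cancel₀ h2
      linear_combination h
    · ring
    · ring

theorem exists_pairComb_eq (h2 : (2 : K) ≠ 0) {x y : (Fin 3 → K) × (Fin 3 → K)} {k : K}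
    (hy : bqJac y ≠ 0) (hk : k ≠ 0) (h : bqJac x = k • bqJac y) :
    ∃ g : GL (Fin 2) K, (g : Matrix (Fin 2) (Fin 2) K).det = k ∧
      x = pairComb (g : Matrix (Fin 2) (Fin 2) K) y := by
  have e (i : Fin 3) : bqJac x i = k * bqJac y i := congrFun h i
  obtain ⟨a, b, hab⟩ := exists_eq_comb h2 hy (A := x.1) <| by
    apply mul_left_cancel₀ hk
    have : 2 * x.1 0 * bqJac x 2 - x.1 1 * bqJac x 1 + 2 * x.1 2 * bqJac x 0 = 0 := by
      simp only [bqJac, Matrix.cons_val]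
      ring
    rw [e, e, e] at this
    linear_combination this
  obtain ⟨c, d, hcd⟩ := exists_eq_comb h2 hy (A := x.2) <| by
    apply mul_left_cancel₀ hk
    have : 2 * x.2 0 * bqJac x 2 - x.2 1 * bqJac x 1 + 2 * x.2 2 * bqJac x 0 = 0 := by
      simp only [bqJac, Matrix.cons_val]
      ring
    rw [e, e, e] at this
    linear_combination this
  have hx : x = pairComb !![a, b; c, d] y := by
    simp [pairComb, ← hab, ← hcd]
  have hdet : (!![a, b; c, d] : Matrix (Fin 2) (Fin 2) K).det = k := by
    rw [hx, bqJac_pairComb] at h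
    exact smul_left_injective K hy h
  obtain ⟨g, hg⟩ := exists_gl (hdet ▸ hk)
  exact ⟨g, by rw [hg, hdet], by rw [hg, hx]⟩

theorem inOrbitPB_iff_formSim_bqJac (h2 : (2 : K) ≠ 0) {y : (Fin 3 → K) × (Fin 3 → K)}
    (hy : bqJac y ≠ 0) (x : (Fin 3 → K) × (Fin 3 → K)) :
    InOrbitPB y x ↔ FormSim (bqJac y) (bqJac x) := by
  rw [inOrbitPB_iff]
  constructor
  · rintro ⟨g₁, g₂, rfl⟩
    exact ⟨_, mul_ne_zero (gl_det_ne_zero g₁) (gl_det_ne_zero g₂), g₂, by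
      rw [bqJac_pairComb, bqJac_bqSubst, smul_smul]⟩
  · rintro ⟨k, hk, g, hg⟩
    have hdet := gl_det_ne_zero g
    have hJ := bqJac_bqSubst (g : Matrix (Fin 2) (Fin 2) K) y
    obtain ⟨g₁, -, h⟩ := exists_pairComb_eq h2
      (hJ ▸ smul_ne_zero hdet (bqSubst_ne_zero g hy)) (div_ne_zero hk hdet)
      (by rw [hg, hJ, smul_smul, div_mul_cancel₀ _ hdet])
    exact ⟨g₁, g, h⟩

theorem exists_smul_of_bqJac_eq_zero (h2 : (2 : K) ≠ 0) {x : (Fin 3 → K) × (Fin 3 → K)}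
    (hx : bqJac x = 0) (h1 : x.1 ≠ 0) : ∃ t : K, x.2 = t • x.1 := by
  have e0 : x.1 0 * x.2 1 - x.1 1 * x.2 0 = 0 := congrFun hx 0
  have e1 : 2 * (x.1 0 * x.2 2 - x.1 2 * x.2 0) = 0 := congrFun hx 1
  have e2 : x.1 1 * x.2 2 - x.1 2 * x.2 1 = 0 := congrFun hx 2
  replace e1 := (mul_eq_zero.1 e1).resolve_left h2
  rcases ne_zero_three h1 with h | h | h
  · refine ⟨x.2 0 / x.1 0, funext_three ?_ ?_ ?_⟩ <;> simp only [Pi.smul_apply, smul_eq_mul] <;>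
      field_simp
    · linear_combination e0
    · linear_combination e1
  · refine ⟨x.2 1 / x.1 1, funext_three ?_ ?_ ?_⟩ <;> simp only [Pi.smul_apply, smul_eq_mul] <;>
      field_simp
    · linear_combination -e0
    · linear_combination e2
  · refine ⟨x.2 2 / x.1 2, funext_three ?_ ?_ ?_⟩ <;> simp only [Pi.smul_apply, smul_eq_mul] <;>
      field_simp
    · linear_combination -e1
    · linear_combination -e2

theorem inOrbitPB_zero_iff_formSim_pairRep (h2 : (2 : K) ≠ 0) {Q : Fin 3 → K} (hQ : Q ≠ 0)
    (x : (Fin 3 → K) × (Fin 3 → K)) :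
    InOrbitPB (0, Q) x ↔ bqJac x = 0 ∧ FormSim Q (pairRep x) := by
  rw [inOrbitPB_iff]
  constructor
  · rintro ⟨g₁, g₂, rfl⟩
    refine ⟨?_, ?_⟩
    · rw [bqJac_pairComb, bqSubst_zero]
      apply funext_three <;> simp [bqJac]
    · have hS := bqSubst_ne_zero g₂ hQ
      have hd := gl_det_ne_zero g₁
      rw [Matrix.det_fin_two] at hd
      by_cases hb : (g₁ : Matrix (Fin 2) (Fin 2) K) 0 1 = 0
      · refine ⟨(g₁ : Matrix (Fin 2) (Fin 2) K) 1 1, ?_, g₂, ?_⟩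
        · rintro h
          simp [h, hb] at hd
        · simp [pairRep, pairComb, bqSubst_zero, hb]
      · exact ⟨_, hb, g₂, by simp [pairRep, pairComb, bqSubst_zero, hb, hS]⟩
  · rintro ⟨hx, k, hk, g, hg⟩
    unfold pairRep at hg
    split_ifs at hg with h
    · obtain ⟨g₁, hg₁⟩ := exists_gl (M := !![1, 0; 0, k]) (by simpa using hk)
      exact ⟨g₁, g, Prod.ext (by simp [hg₁, pairComb, bqSubst_zero, h])
        (by simp [hg₁, pairComb, hg])⟩
    · obtain ⟨t, ht⟩ := exists_smul_of_bqJac_eq_zero h2 hx h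
      obtain ⟨g₁, hg₁⟩ := exists_gl (M := !![0, k; 1, t * k]) (by simpa using hk)
      exact ⟨g₁, g, Prod.ext (by simp [hg₁, pairComb, hg])
        (by rw [ht, hg]; simp [hg₁, pairComb, bqSubst_zero, smul_smul])⟩

theorem inOrbitPB_zero_iff (x : (Fin 3 → K) × (Fin 3 → K)) :
    InOrbitPB (0, 0) x ↔ bqJac x = 0 ∧ pairRep x = 0 := by
  rw [inOrbitPB_iff]
  constructor
  · rintro ⟨g₁, g₂, rfl⟩
    constructor
    · apply funext_three <;> simp [bqJac, pairComb, bqSubst_zero]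
    · simp [pairRep, pairComb, bqSubst_zero]
  · rintro ⟨-, hx⟩
    unfold pairRep at hx
    split_ifs at hx with h
    · exact ⟨1, 1, Prod.ext (by simp [pairComb, bqSubst_zero, h])
        (by simp [pairComb, bqSubst_zero, hx])⟩
    · exact absurd hx h

/-! ### Ranks -/

theorem rank_coeffMatPB_eq_two {x : (Fin 3 → K) × (Fin 3 → K)} (hx : bqJac x ≠ 0) :
    (coeffMatPB x).rank = 2 := by
  have h : LinearIndependent K (coeffMatPB x).row := by
    rw [Fintype.linearIndependent_iff]
    intro c hc
    have := pairComb_injective hx (s := c 0) (t := c 1) <| by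
      rw [← hc]
      apply funext_three <;> simp [coeffMatPB, Fin.sum_univ_two, Matrix.row]
    intro i
    fin_cases i
    exacts [this.1, this.2]
  simpa using h.rank_matrix

theorem rank_coeffMatPB_eq_one (h2 : (2 : K) ≠ 0) {x : (Fin 3 → K) × (Fin 3 → K)}
    (hx : bqJac x = 0) (hr : pairRep x ≠ 0) : (coeffMatPB x).rank = 1 := by
  have hle : (coeffMatPB x).rank ≤ 1 := by
    by_cases h : x.1 = 0
    · convert Matrix.rank_vecMulVec_le ![0, 1] x.2
      ext i j
      fin_cases i <;> fin_cases j <;> simp [coeffMatPB, h, Matrix.vecMulVec_apply]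
    · obtain ⟨t, ht⟩ := exists_smul_of_bqJac_eq_zero h2 hx h
      convert Matrix.rank_vecMulVec_le ![1, t] x.1
      ext i j
      fin_cases i <;> fin_cases j <;> simp [coeffMatPB, ht, Matrix.vecMulVec_apply]
  refine le_antisymm hle (Nat.one_le_iff_ne_zero.2 fun h0 => hr ?_)
  have hz : coeffMatPB x = 0 := by
    rw [Matrix.rank, Submodule.finrank_eq_zero, LinearMap.range_eq_bot] at h0
    exact Matrix.toLin'.map_eq_zero_iff.1 h0
  have e (i j) := congrFun (congrFun hz i) j
  have h1 : x.1 = 0 := funext_three (e 0 0) (e 0 1) (e 0 2)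
  have h2 : x.2 = 0 := funext_three (e 1 0) (e 1 1) (e 1 2)
  simp [pairRep, h1, h2]

theorem rank_coeffMatPB_eq_zero {x : (Fin 3 → K) × (Fin 3 → K)} (hr : pairRep x = 0) :
    (coeffMatPB x).rank = 0 := by
  unfold pairRep at hr
  split_ifs at hr with h
  · convert Matrix.rank_zero (m := Fin 2) (n := Fin 3) (R := K)
    ext i j
    fin_cases i <;> fin_cases j <;> simp [coeffMatPB, h, hr]
  · exact absurd hr h

/-! ### Counting -/

theorem card_bqDisc_mem (h2 : (2 : F) ≠ 0) (D : Set F) :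
    Nat.card {Q : Fin 3 → F // bqDisc Q ∈ D} =
      (Nat.card F - 1) * (Nat.card F * Nat.card D) +
        Nat.card {b : F // b ^ 2 ∈ D} * Nat.card F := by
  have h4 : (4 : F) ≠ 0 := by
    have := mul_ne_zero h2 h2
    norm_num at this
    exact this
  rw [← Nat.card_units, ← Nat.card_prod, ← Nat.card_prod, ← Nat.card_prod, ← Nat.card_sum]
  symm
  refine Nat.card_eq_of_bijective (Sum.elim
    (fun z : Fˣ × F × D => ⟨![z.1, z.2.1, (z.2.1 ^ 2 - z.2.2) / (4 * z.1)], ?_⟩)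
    (fun z : {b : F // b ^ 2 ∈ D} × F => ⟨![0, z.1, z.2], ?_⟩)) ⟨?_, ?_⟩
  · convert z.2.2.2 using 1
    have := z.1.ne_zero
    simp only [bqDisc, Matrix.cons_val]
    field_simp
    ring
  · simpa [bqDisc] using z.1.2
  · rintro (⟨a, b, d⟩ | ⟨b, c⟩) (⟨a', b', d'⟩ | ⟨b', c'⟩) h <;>
      have e0 := congrFun (congrArg Subtype.val h) 0 <;>
      have e1 := congrFun (congrArg Subtype.val h) 1 <;>
      have e2 := congrFun (congrArg Subtype.val h) 2 <;>
      simp only [Sum.elim_inl, Sum.elim_inr, Matrix.cons_val] at e0 e1 e2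
    · have ha := a.ne_zero
      obtain rfl := Units.ext e0
      subst e1
      rw [div_left_inj' (mul_ne_zero h4 ha), sub_right_inj] at e2
      rw [Subtype.ext e2]
    · exact absurd e0 a.ne_zero
    · exact absurd e0.symm a'.ne_zero
    · rw [Subtype.ext e1, e2]
  · rintro ⟨Q, hQ⟩
    by_cases ha : Q 0 = 0
    · refine ⟨Sum.inr (⟨Q 1, by simpa [bqDisc, ha] using hQ⟩, Q 2), Subtype.ext ?_⟩
      apply funext_three <;> simp [ha]
    · refine ⟨Sum.inl (Units.mk0 (Q 0) ha, Q 1, ⟨bqDisc Q, hQ⟩), Subtype.ext ?_⟩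
      apply funext_three <;> simp [bqDisc]
      field_simp

theorem card_nonzero_isSquare {l : F} (hl : ¬ IsSquare l) :
    Nat.card {d : F | d ≠ 0 ∧ IsSquare d} = Nat.card {d : F | ¬ IsSquare d} := by
  have hl0 : l ≠ 0 := by
    rintro rfl
    exact hl IsSquare.zero
  refine Nat.card_eq_of_bijective (fun d => ⟨l * d, ?_⟩) ⟨?_, ?_⟩
  · obtain ⟨d, hd, s, hs⟩ := d
    rw [hs] at hd
    change ¬ IsSquare (l * d)
    rwa [hs, mul_comm, ← pow_two, isSquare_sq_mul_iff (left_ne_zero_of_mul hd)]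
  · intro d d' h
    exact Subtype.ext (mul_left_cancel₀ hl0 (congrArg Subtype.val h))
  · rintro ⟨d, hd⟩
    have hd0 : d ≠ 0 := by
      rintro rfl
      exact hd IsSquare.zero
    refine ⟨⟨l⁻¹ * d, mul_ne_zero (inv_ne_zero hl0) hd0, ?_⟩,
      Subtype.ext (mul_inv_cancel_left₀ hl0 d)⟩
    exact isSquare_mul_of_not_isSquare (by rwa [isSquare_inv]) hd

theorem two_mul_card_not_isSquare {l : F} (hl : ¬ IsSquare l) :
    2 * Nat.card {d : F | ¬ IsSquare d} = Nat.card F - 1 := by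
  rw [two_mul]
  nth_rw 1 [← card_nonzero_isSquare hl]
  rw [Nat.card_coe_set_eq, Nat.card_coe_set_eq, ← Set.ncard_union_eq, ← Nat.card_units,
    ← Nat.card_congr unitsEquivNeZero.symm]
  · change _ = Nat.card {a : F | a ≠ 0}
    rw [Nat.card_coe_set_eq]
    congr 1
    ext d
    simp only [Set.mem_union, Set.mem_ofPred_eq]
    constructor
    · rintro (h | h)
      · exact h.1
      · rintro rfl
        exact h IsSquare.zero
    · tauto
  · rw [Set.disjoint_left]
    rintro d ⟨-, h⟩ h'
    exact h' h

theorem card_bqDisc_eq_zero (h2 : (2 : F) ≠ 0) :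
    Nat.card {Q : Fin 3 → F // Q ≠ 0 ∧ bqDisc Q = 0} = Nat.card F ^ 2 - 1 := by
  have h := card_bqDisc_mem h2 ({0} : Set F)
  have h1 : Nat.card {b : F // b ^ 2 ∈ ({0} : Set F)} = 1 := by
    rw [Nat.card_eq_one_iff_unique]
    refine ⟨⟨fun a b => Subtype.ext ?_⟩, ⟨⟨0, by simp⟩⟩⟩
    rw [pow_eq_zero_iff two_ne_zero |>.1 a.2, pow_eq_zero_iff two_ne_zero |>.1 b.2]
  have hq : 1 ≤ Nat.card F := Nat.card_pos
  have hs : Nat.card {Q : Fin 3 → F // bqDisc Q ∈ ({0} : Set F)} =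
      Nat.card {Q : Fin 3 → F // Q ≠ 0 ∧ bqDisc Q = 0} + 1 := by
    rw [← Finite.card_option]
    symm
    refine Nat.card_eq_of_bijective
      (fun o => o.elim ⟨0, by simp [bqDisc]⟩ fun Q => ⟨Q.1, Q.2.2⟩) ⟨?_, ?_⟩
    · rintro (_ | Q) (_ | Q') h
      · rfl
      · exact absurd (congrArg Subtype.val h).symm Q'.2.1
      · exact absurd (congrArg Subtype.val h) Q.2.1
      · exact congrArg some (Subtype.ext (Subtype.mk.inj h))
    · rintro ⟨Q, hQ⟩
      by_cases h : Q = 0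
      · exact ⟨none, Subtype.ext h.symm⟩
      · exact ⟨some ⟨Q, h, hQ⟩, rfl⟩
  rw [hs, h1, Nat.card_unique (α := ({0} : Set F)), mul_one, one_mul,
    ← Nat.succ_mul, Nat.succ_eq_add_one, Nat.sub_add_cancel hq, ← pow_two] at h
  omega

theorem card_bqDisc_isSquare (h2 : (2 : F) ≠ 0) {l : F} (hl : ¬ IsSquare l) :
    (Nat.card {Q : Fin 3 → F // Q ≠ 0 ∧ bqDisc Q ≠ 0 ∧ IsSquare (bqDisc Q)} : ℚ) =
      Nat.card F * ((Nat.card F : ℚ) ^ 2 - 1) / 2 := by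
  have h := card_bqDisc_mem h2 {d : F | d ≠ 0 ∧ IsSquare d}
  have h1 : Nat.card {b : F // b ^ 2 ∈ {d : F | d ≠ 0 ∧ IsSquare d}} = Nat.card F - 1 := by
    rw [← Nat.card_units, Nat.card_congr unitsEquivNeZero]
    exact Nat.card_congr (Equiv.subtypeEquivRight fun b => by simp [IsSquare.sq])
  have hs : Nat.card {Q : Fin 3 → F // bqDisc Q ∈ {d : F | d ≠ 0 ∧ IsSquare d}} =
      Nat.card {Q : Fin 3 → F // Q ≠ 0 ∧ bqDisc Q ≠ 0 ∧ IsSquare (bqDisc Q)} :=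
    Nat.card_congr (Equiv.subtypeEquivRight fun Q =>
      ⟨fun h => ⟨fun h0 => h.1 (by simp [h0, bqDisc]), h⟩, And.right⟩)
  have hc := two_mul_card_not_isSquare hl
  rw [hs, h1, card_nonzero_isSquare hl] at h
  rw [h]
  have hq : 1 ≤ Nat.card F := Nat.card_pos
  have hc' : (2 : ℚ) * (Nat.card {d : F | ¬ IsSquare d} : ℕ) = (Nat.card F : ℚ) - 1 := by
    have := congrArg (Nat.cast (R := ℚ)) hc
    push_cast [hq] at this
    exact this
  push_cast [hq]
  linear_combination ((Nat.card F : ℚ) - 1) * Nat.card F / 2 * hc'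

theorem card_bqDisc_not_isSquare (h2 : (2 : F) ≠ 0) {l : F} (hl : ¬ IsSquare l) :
    (Nat.card {Q : Fin 3 → F // Q ≠ 0 ∧ ¬ IsSquare (bqDisc Q)} : ℚ) =
      Nat.card F * ((Nat.card F : ℚ) - 1) ^ 2 / 2 := by
  have h := card_bqDisc_mem h2 {d : F | ¬ IsSquare d}
  have h1 : Nat.card {b : F // b ^ 2 ∈ {d : F | ¬ IsSquare d}} = 0 := by
    have : IsEmpty {b : F // b ^ 2 ∈ {d : F | ¬ IsSquare d}} := ⟨fun b => b.2 (IsSquare.sq _)⟩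
    exact Nat.card_of_isEmpty
  have hs : Nat.card {Q : Fin 3 → F // bqDisc Q ∈ {d : F | ¬ IsSquare d}} =
      Nat.card {Q : Fin 3 → F // Q ≠ 0 ∧ ¬ IsSquare (bqDisc Q)} :=
    Nat.card_congr (Equiv.subtypeEquivRight fun Q =>
      ⟨fun h => ⟨fun h0 => h (by simp [h0, bqDisc]), h⟩, And.right⟩)
  have hc := two_mul_card_not_isSquare hl
  rw [hs, h1] at h
  rw [h]
  have hq : 1 ≤ Nat.card F := Nat.card_pos
  have hc' : (2 : ℚ) * (Nat.card {d : F | ¬ IsSquare d} : ℕ) = (Nat.card F : ℚ) - 1 := by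
    have := congrArg (Nat.cast (R := ℚ)) hc
    push_cast [hq] at this
    exact this
  push_cast [hq]
  linear_combination ((Nat.card F : ℚ) - 1) * Nat.card F / 2 * hc'

theorem card_pairRep (h2 : (2 : F) ≠ 0) {T : (Fin 3 → F) → Prop} (hT : ∀ Q, T Q → Q ≠ 0) :
    Nat.card {x : (Fin 3 → F) × (Fin 3 → F) // bqJac x = 0 ∧ T (pairRep x)} =
      (Nat.card F + 1) * Nat.card {Q : Fin 3 → F // T Q} := by
  rw [← Finite.card_option, ← Nat.card_prod]
  symm
  refine Nat.card_eq_of_bijective (fun z : Option F × {Q : Fin 3 → F // T Q} =>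
    ⟨z.1.elim (0, z.2.1) fun t => (z.2.1, t • z.2.1), ?_⟩) ⟨?_, ?_⟩
  · obtain ⟨_ | t, Q, hQ⟩ := z
    · refine ⟨?_, by simpa [pairRep] using hQ⟩
      apply funext_three <;> simp [bqJac]
    · refine ⟨?_, by simpa [pairRep, hT Q hQ] using hQ⟩
      apply funext_three <;> simp [bqJac] <;> ring_nf; simp
  · rintro ⟨_ | t, Q, hQ⟩ ⟨_ | t', Q', hQ'⟩ h <;>
      have e1 := congrArg Prod.fst (congrArg Subtype.val h) <;>
      have e2 := congrArg Prod.snd (congrArg Subtype.val h) <;>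
      simp only [Option.elim] at e1 e2
    · subst e2
      rfl
    · exact absurd e1.symm (hT _ hQ')
    · exact absurd e1 (hT _ hQ)
    · subst e1
      rw [smul_left_injective F (hT _ hQ) e2]
  · rintro ⟨⟨A, B⟩, hJ, hR⟩
    by_cases hA : A = 0
    · subst hA
      exact ⟨(none, ⟨B, by simpa [pairRep] using hR⟩), rfl⟩
    · obtain ⟨t, ht⟩ := exists_smul_of_bqJac_eq_zero h2 hJ hA
      exact ⟨(some t, ⟨A, by simpa [pairRep, hA] using hR⟩), Subtype.ext (Prod.ext rfl ht.symm)⟩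

theorem bqJac_surjective (h2 : (2 : K) ≠ 0) (N : Fin 3 → K) :
    ∃ y : (Fin 3 → K) × (Fin 3 → K), bqJac y = N := by
  by_cases h0 : N 0 = 0
  · by_cases h1 : N 1 = 0
    · exact ⟨(![0, 1, 0], ![0, 0, N 2]), by apply funext_three <;> simp [bqJac, h0, h1]⟩
    · refine ⟨(![1, 2 * N 2 / N 1, 0], ![0, 0, N 1 / 2]), ?_⟩
      apply funext_three <;> simp [bqJac, h0] <;> field_simp
  · refine ⟨(![1, 0, -(N 2 / N 0)], ![0, N 0, N 1 / 2]), ?_⟩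
    apply funext_three <;> simp [bqJac] <;> field_simp

theorem card_bqJac (h2 : (2 : K) ≠ 0) {T : (Fin 3 → K) → Prop} (hT : ∀ Q, T Q → Q ≠ 0)
    (hs : ∀ (k : K) Q, k ≠ 0 → (T (k • Q) ↔ T Q)) :
    Nat.card Kˣ * Nat.card {x : (Fin 3 → K) × (Fin 3 → K) // T (bqJac x)} =
      Nat.card (GL (Fin 2) K) * Nat.card {Q : Fin 3 → K // T Q} := by
  choose y hy using bqJac_surjective (K := K) h2
  rw [← Nat.card_prod, ← Nat.card_prod]
  symm
  refine Nat.card_eq_of_bijective (fun z : GL (Fin 2) K × {Q : Fin 3 → K // T Q} =>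
    (Matrix.GeneralLinearGroup.det z.1,
      ⟨pairComb (z.1 : Matrix (Fin 2) (Fin 2) K) (y z.2.1), ?_⟩)) ⟨?_, ?_⟩
  · rw [bqJac_pairComb, hy, hs _ _ (gl_det_ne_zero _)]
    exact z.2.2
  · rintro ⟨g, Q, hQ⟩ ⟨g', Q', hQ'⟩ h
    have hd : (g : Matrix (Fin 2) (Fin 2) K).det = (g' : Matrix (Fin 2) (Fin 2) K).det :=
      congrArg Units.val (congrArg Prod.fst h)
    have hx : pairComb (g : Matrix (Fin 2) (Fin 2) K) (y Q) =
        pairComb (g' : Matrix (Fin 2) (Fin 2) K) (y Q') :=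
      congrArg Subtype.val (congrArg Prod.snd h)
    have hJ := congrArg bqJac hx
    rw [bqJac_pairComb, bqJac_pairComb, hy, hy, hd] at hJ
    obtain rfl : Q = Q' := smul_right_injective _ (gl_det_ne_zero g') hJ
    have hi : bqJac (y Q) ≠ 0 := by
      rw [hy]
      exact hT Q hQ
    have row (i : Fin 2) (hi' : (g : Matrix (Fin 2) (Fin 2) K) i 0 • (y Q).1 +
        (g : Matrix (Fin 2) (Fin 2) K) i 1 • (y Q).2 =
        (g' : Matrix (Fin 2) (Fin 2) K) i 0 • (y Q).1 +
        (g' : Matrix (Fin 2) (Fin 2) K) i 1 • (y Q).2) (j : Fin 2) :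
        (g : Matrix (Fin 2) (Fin 2) K) i j = (g' : Matrix (Fin 2) (Fin 2) K) i j := by
      have := pairComb_injective hi (s := (g : Matrix (Fin 2) (Fin 2) K) i 0 -
          (g' : Matrix (Fin 2) (Fin 2) K) i 0) (t := (g : Matrix (Fin 2) (Fin 2) K) i 1 -
          (g' : Matrix (Fin 2) (Fin 2) K) i 1) (by
        rw [sub_smul, sub_smul, sub_add_sub_comm, hi', sub_self])
      fin_cases j
      exacts [sub_eq_zero.1 this.1, sub_eq_zero.1 this.2]
    have : g = g' := by
      apply Units.ext
      ext i j
      fin_cases i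
      exacts [row 0 (congrArg Prod.fst hx) j, row 1 (congrArg Prod.snd hx) j]
    rw [this]
  · rintro ⟨k, x, hx⟩
    have hk := k.ne_zero
    have hQ : T ((k : K)⁻¹ • bqJac x) := (hs _ _ (inv_ne_zero hk)).2 hx
    obtain ⟨g, hg, hgx⟩ := exists_pairComb_eq h2 (x := x) (y := y ((k : K)⁻¹ • bqJac x)) (k := k)
      (by rw [hy]; exact hT _ hQ) hk (by rw [hy, smul_inv_smul₀ hk])
    exact ⟨(g, ⟨_, hQ⟩), Prod.ext (Units.ext hg) (Subtype.ext hgx.symm)⟩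

theorem card_bqJac_rat (h2 : (2 : F) ≠ 0) {T : (Fin 3 → F) → Prop} (hT : ∀ Q, T Q → Q ≠ 0)
    (hs : ∀ (k : F) Q, k ≠ 0 → (T (k • Q) ↔ T Q)) :
    (Nat.card {x : (Fin 3 → F) × (Fin 3 → F) // T (bqJac x)} : ℚ) =
      Nat.card F * ((Nat.card F : ℚ) ^ 2 - 1) * Nat.card {Q : Fin 3 → F // T Q} := by
  have h := congrArg (Nat.cast (R := ℚ)) (card_bqJac h2 hT hs)
  have hq : 1 < Nat.card F := Finite.one_lt_card
  have hq2 : Nat.card F ≤ Nat.card F ^ 2 := Nat.le_self_pow two_ne_zero _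
  have hq3 : 1 ≤ Nat.card F ^ 2 := hq.le.trans hq2
  rw [Matrix.card_GL_field, Fin.prod_univ_two, Nat.card_units] at h
  simp only [← Nat.card_eq_fintype_card, Fin.val_zero, Fin.val_one, pow_zero, pow_one] at h
  push_cast [hq.le, hq2, hq3] at h
  have hne : (Nat.card F : ℚ) - 1 ≠ 0 := sub_ne_zero.2 (by exact_mod_cast hq.ne')
  apply mul_left_cancel₀ hne
  linear_combination h

/-- orbits of `GL₂(F_q) × GL₂(F_q)` on pairs of binary quadratic forms. -/
theorem stmt15 (p : ℕ) [Fact p.Prime] [CharP F p] (hp : p ≠ 2) (l : F) (hl : ¬ IsSquare l) :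
    let r : Fin 7 → (Fin 3 → F) × (Fin 3 → F) :=
      ![(![0,0,0], ![0,0,0]), (![0,0,0], ![0,0,1]), (![0,0,0], ![0,1,0]),
        (![0,0,0], ![1,0,-l]), (![0,0,1], ![0,1,0]), (![0,0,1], ![1,0,0]),
        (![0,1,0], ![1,0,l])]
    let q : ℚ := (Fintype.card F : ℚ)
    (∀ i j : Fin 7, i ≠ j →
      ¬ ∃ x : (Fin 3 → F) × (Fin 3 → F), InOrbitPB (r i) x ∧ InOrbitPB (r j) x) ∧
    (∀ x : (Fin 3 → F) × (Fin 3 → F), ∃ i : Fin 7, InOrbitPB (r i) x) ∧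
    (∀ (i : Fin 7) (x : (Fin 3 → F) × (Fin 3 → F)), InOrbitPB (r i) x →
      (coeffMatPB x).rank = ![0,1,1,1,2,2,2] i) ∧
    (∀ i : Fin 7, (Nat.card {x : (Fin 3 → F) × (Fin 3 → F) // InOrbitPB (r i) x} : ℚ) =
      ![1, (q-1)*(q+1)^2, q*(q-1)*(q+1)^2/2, q*(q-1)^2*(q+1)/2, q*(q^2-1)^2,
        (q^3-q)^2/2, (q^2-q)^2*(q^2-1)/2] i) := by
  have h2 : (2 : F) ≠ 0 := by
    have h := (CharP.cast_eq_zero_iff F p 2).not.2 fun h =>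
      hp ((Nat.prime_dvd_prime_iff_eq Fact.out Nat.prime_two).1 h)
    exact_mod_cast h
  intro r q
  have hq : q = Nat.card F := by rw [Nat.card_eq_fintype_card]
  have hJ4 : bqJac ((![0, 0, 1] : Fin 3 → F), ![0, 1, 0]) = (-1 : F) • ![0, 0, 1] := by
    apply funext_three <;> simp [bqJac]
  have hJ5 : bqJac ((![0, 0, 1] : Fin 3 → F), ![1, 0, 0]) = (-2 : F) • ![0, 1, 0] := by
    apply funext_three <;> simp [bqJac]
  have hJ6 : bqJac (![0, 1, 0], ![1, 0, l]) = (-1 : F) • ![1, 0, -l] := by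
    apply funext_three <;> simp [bqJac]
  have hn : (-1 : F) ≠ 0 := neg_ne_zero.2 one_ne_zero
  have hn2 : (-2 : F) ≠ 0 := neg_ne_zero.2 h2
  have hz : (![0, 0, 0] : Fin 3 → F) = 0 := by
    apply funext_three <;> rfl
  have hQ1 : (![0, 0, 1] : Fin 3 → F) ≠ 0 := fun h => by simpa using congrFun h 2
  have hQ2 : (![0, 1, 0] : Fin 3 → F) ≠ 0 := fun h => by simpa using congrFun h 1
  have hQ3 : (![1, 0, -l] : Fin 3 → F) ≠ 0 := fun h => by simpa using congrFun h 0
  have orb0 (x) : InOrbitPB (r 0) x ↔ bqJac x = 0 ∧ pairRep x = 0 := by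
    change InOrbitPB (![0, 0, 0], ![0, 0, 0]) x ↔ _
    rw [hz]
    exact inOrbitPB_zero_iff x
  have orb1 (x) : InOrbitPB (r 1) x ↔ bqJac x = 0 ∧ pairRep x ≠ 0 ∧ bqDisc (pairRep x) = 0 := by
    change InOrbitPB (![0, 0, 0], ![0, 0, 1]) x ↔ _
    rw [hz, inOrbitPB_zero_iff_formSim_pairRep h2 hQ1, formSim_square_iff h2]
  have orb2 (x) : InOrbitPB (r 2) x ↔ bqJac x = 0 ∧ pairRep x ≠ 0 ∧ bqDisc (pairRep x) ≠ 0 ∧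
      IsSquare (bqDisc (pairRep x)) := by
    change InOrbitPB (![0, 0, 0], ![0, 1, 0]) x ↔ _
    rw [hz, inOrbitPB_zero_iff_formSim_pairRep h2 hQ2, formSim_split_iff h2]
  have orb3 (x) : InOrbitPB (r 3) x ↔ bqJac x = 0 ∧ pairRep x ≠ 0 ∧
      ¬ IsSquare (bqDisc (pairRep x)) := by
    change InOrbitPB (![0, 0, 0], ![1, 0, -l]) x ↔ _
    rw [hz, inOrbitPB_zero_iff_formSim_pairRep h2 hQ3, formSim_nonsplit_iff h2 hl]
  have orb4 (x) : InOrbitPB (r 4) x ↔ bqJac x ≠ 0 ∧ bqDisc (bqJac x) = 0 := by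
    change InOrbitPB (![0, 0, 1], ![0, 1, 0]) x ↔ _
    rw [inOrbitPB_iff_formSim_bqJac h2 (hJ4 ▸ smul_ne_zero hn hQ1), hJ4, formSim_smul_left hn,
      formSim_square_iff h2]
  have orb5 (x) : InOrbitPB (r 5) x ↔ bqJac x ≠ 0 ∧ bqDisc (bqJac x) ≠ 0 ∧
      IsSquare (bqDisc (bqJac x)) := by
    change InOrbitPB (![0, 0, 1], ![1, 0, 0]) x ↔ _
    rw [inOrbitPB_iff_formSim_bqJac h2 (hJ5 ▸ smul_ne_zero hn2 hQ2), hJ5, formSim_smul_left hn2,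
      formSim_split_iff h2]
  have orb6 (x) : InOrbitPB (r 6) x ↔ bqJac x ≠ 0 ∧ ¬ IsSquare (bqDisc (bqJac x)) := by
    change InOrbitPB (![0, 1, 0], ![1, 0, l]) x ↔ _
    rw [inOrbitPB_iff_formSim_bqJac h2 (hJ6 ▸ smul_ne_zero hn hQ3), hJ6, formSim_smul_left hn,
      formSim_nonsplit_iff h2 hl]
  refine ⟨?_, ?_, ?_, ?_⟩
  · have key (i x) (hx : InOrbitPB (r i) x) : i =
        if bqJac x = 0 then
          if pairRep x = 0 then 0
          else if IsSquare (bqDisc (pairRep x)) then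
            if bqDisc (pairRep x) = 0 then 1 else 2
          else 3
        else if IsSquare (bqDisc (bqJac x)) then
          if bqDisc (bqJac x) = 0 then 4 else 5
        else 6 := by
      fin_cases i
      · simp [(orb0 x).1 hx]
      · simp [(orb1 x).1 hx]
      · simp [(orb2 x).1 hx]
      · simp [(orb3 x).1 hx]
      · simp [(orb4 x).1 hx]
      · simp [(orb5 x).1 hx]
      · simp [(orb6 x).1 hx]
    rintro i j hij ⟨x, hi, hj⟩
    exact hij ((key i x hi).trans (key j x hj).symm)
  · intro x
    by_cases hJ : bqJac x = 0
    · by_cases hR : pairRep x = 0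
      · exact ⟨0, (orb0 x).2 ⟨hJ, hR⟩⟩
      by_cases hS : IsSquare (bqDisc (pairRep x))
      · by_cases hD : bqDisc (pairRep x) = 0
        · exact ⟨1, (orb1 x).2 ⟨hJ, hR, hD⟩⟩
        · exact ⟨2, (orb2 x).2 ⟨hJ, hR, hD, hS⟩⟩
      · exact ⟨3, (orb3 x).2 ⟨hJ, hR, hS⟩⟩
    · by_cases hS : IsSquare (bqDisc (bqJac x))
      · by_cases hD : bqDisc (bqJac x) = 0
        · exact ⟨4, (orb4 x).2 ⟨hJ, hD⟩⟩
        · exact ⟨5, (orb5 x).2 ⟨hJ, hD, hS⟩⟩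
      · exact ⟨6, (orb6 x).2 ⟨hJ, hS⟩⟩
  · intro i x hx
    fin_cases i
    · exact rank_coeffMatPB_eq_zero ((orb0 x).1 hx).2
    · exact rank_coeffMatPB_eq_one h2 ((orb1 x).1 hx).1 ((orb1 x).1 hx).2.1
    · exact rank_coeffMatPB_eq_one h2 ((orb2 x).1 hx).1 ((orb2 x).1 hx).2.1
    · exact rank_coeffMatPB_eq_one h2 ((orb3 x).1 hx).1 ((orb3 x).1 hx).2.1
    · exact rank_coeffMatPB_eq_two ((orb4 x).1 hx).1
    · exact rank_coeffMatPB_eq_two ((orb5 x).1 hx).1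
    · exact rank_coeffMatPB_eq_two ((orb6 x).1 hx).1
  · have c1 : (Nat.card {Q : Fin 3 → F // Q ≠ 0 ∧ bqDisc Q = 0} : ℚ) = q ^ 2 - 1 := by
      rw [card_bqDisc_eq_zero h2, hq, Nat.cast_sub (Nat.one_le_pow _ _ Nat.card_pos)]
      push_cast
      rfl
    have c2 := card_bqDisc_isSquare h2 hl
    have c3 := card_bqDisc_not_isSquare h2 hl
    rw [← hq] at c2 c3
    have hd (k : F) (Q : Fin 3 → F) (hk : k ≠ 0) : bqDisc (k • Q) = 0 ↔ bqDisc Q = 0 := by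
      rw [bqDisc_smul, mul_eq_zero, or_iff_right (pow_ne_zero 2 hk)]
    have hsq (k : F) (Q : Fin 3 → F) (hk : k ≠ 0) :
        IsSquare (bqDisc (k • Q)) ↔ IsSquare (bqDisc Q) := by
      rw [bqDisc_smul, isSquare_sq_mul_iff hk]
    have hne (k : F) (Q : Fin 3 → F) (hk : k ≠ 0) : k • Q ≠ 0 ↔ Q ≠ 0 := smul_ne_zero_iff_right hk
    intro i
    fin_cases i
    · have : {x // InOrbitPB (r 0) x} = {x // x = (0 : (Fin 3 → F) × (Fin 3 → F))} := by
        congr 1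
        ext x
        rw [orb0]
        constructor
        · rintro ⟨-, h⟩
          unfold pairRep at h
          split_ifs at h with h'
          · exact Prod.ext h' h
          · exact absurd h h'
        · rintro rfl
          exact ⟨funext_three (by simp [bqJac]) (by simp [bqJac]) (by simp [bqJac]),
            by simp [pairRep]⟩
      change (Nat.card {x // InOrbitPB (r 0) x} : ℚ) = 1
      rw [this, Nat.card_unique, Nat.cast_one]
    · change (Nat.card {x // InOrbitPB (r 1) x} : ℚ) = (q - 1) * (q + 1) ^ 2
      rw [Nat.card_congr (Equiv.subtypeEquivRight orb1),
        card_pairRep h2 (T := fun Q => Q ≠ 0 ∧ bqDisc Q = 0) fun Q => And.left]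
      push_cast
      rw [c1, ← hq]
      ring
    · change (Nat.card {x // InOrbitPB (r 2) x} : ℚ) = q * (q - 1) * (q + 1) ^ 2 / 2
      rw [Nat.card_congr (Equiv.subtypeEquivRight orb2),
        card_pairRep h2 (T := fun Q => Q ≠ 0 ∧ bqDisc Q ≠ 0 ∧ IsSquare (bqDisc Q))
          fun Q => And.left]
      push_cast
      rw [c2, ← hq]
      ring
    · change (Nat.card {x // InOrbitPB (r 3) x} : ℚ) = q * (q - 1) ^ 2 * (q + 1) / 2
      rw [Nat.card_congr (Equiv.subtypeEquivRight orb3),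
        card_pairRep h2 (T := fun Q => Q ≠ 0 ∧ ¬ IsSquare (bqDisc Q))
          fun Q => And.left]
      push_cast
      rw [c3, ← hq]
      ring
    · change (Nat.card {x // InOrbitPB (r 4) x} : ℚ) = q * (q ^ 2 - 1) ^ 2
      rw [Nat.card_congr (Equiv.subtypeEquivRight orb4),
        card_bqJac_rat h2 (T := fun Q => Q ≠ 0 ∧ bqDisc Q = 0) (fun Q => And.left)
          fun k Q hk => by rw [hne k Q hk, hd k Q hk], c1, ← hq]
      ring
    · change (Nat.card {x // InOrbitPB (r 5) x} : ℚ) = (q ^ 3 - q) ^ 2 / 2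
      rw [Nat.card_congr (Equiv.subtypeEquivRight orb5),
        card_bqJac_rat h2 (T := fun Q => Q ≠ 0 ∧ bqDisc Q ≠ 0 ∧ IsSquare (bqDisc Q))
          (fun Q => And.left)
          fun k Q hk => by rw [hne k Q hk, (hd k Q hk).ne, hsq k Q hk], c2, ← hq]
      ring
    · change (Nat.card {x // InOrbitPB (r 6) x} : ℚ) = (q ^ 2 - q) ^ 2 * (q ^ 2 - 1) / 2
      rw [Nat.card_congr (Equiv.subtypeEquivRight orb6),
        card_bqJac_rat h2 (T := fun Q => Q ≠ 0 ∧ ¬ IsSquare (bqDisc Q)) (fun Q => And.left)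
          fun k Q hk => by rw [hne k Q hk, hsq k Q hk], c3, ← hq]
      ring

end
end
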